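/- Let q be an odd prime power and let H₂ be the orbit of the point (0, ξ^{(q−1)/2}, 1, 0) under the group K ≅ PSL(2,q²) (induced on PG(3,q²) by the matrices A^q ⊗ A with A ∈ SL(2,𝔽_{q²})). For every j ∈ {1,…,q}\{(q+1)/2}, the set S_j ∪ H₂ is a quasi-Hermitian surface of PG(3,q²): it has exactly (q²+1)(q³+1) points, and every plane of PG(3,q²) meets it in either q³+1 or q³+q²+1 points. -/

import Mathlib

noncomputable section

open Matrix

/-- The points of `PG(3,q²)`: the projectivization of `F⁴` where `F = 𝔽_{q²}`. -/
abbrev PGPoint (F : Type*) [Field F] := Projectivization F (Fin 4 → F)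

/-- The form `F_γ(X₁,X₂,X₃,X₄) = X₁^q X₄ + X₁ X₄^q − X₂^{q+1} − X₃^{q+1}
    − γ (X₁X₄ − X₂X₃)^{(q+1)/2}`. -/
def Fgam {F : Type*} [Field F] (q : ℕ) (γ : F) (x : Fin 4 → F) : F :=
  x 0 ^ q * x 3 + x 0 * x 3 ^ q - x 1 ^ (q + 1) - x 2 ^ (q + 1)
    - γ * (x 0 * x 3 - x 1 * x 2) ^ ((q + 1) / 2)

/-- The point set `C_γ` of `PG(3,q²)`, the zero locus of `F_γ`. -/
def Cgam {F : Type*} [Field F] (q : ℕ) (γ : F) : Set (PGPoint F) :=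
  {P | ∀ (v : Fin 4 → F) (hv : v ≠ 0), P = Projectivization.mk F v hv → Fgam q γ v = 0}

/-- Kronecker product of two 2×2 matrices, as a 4×4 matrix. -/
def kron {F : Type*} [Field F] (A B : Matrix (Fin 2) (Fin 2) F) :
    Matrix (Fin 4) (Fin 4) F :=
  Matrix.of fun i j =>
    A ⟨i.val / 2, by have := i.isLt; omega⟩ ⟨j.val / 2, by have := j.isLt; omega⟩ *
    B ⟨i.val % 2, by have := i.isLt; omega⟩ ⟨j.val % 2, by have := j.isLt; omega⟩

/-- Entrywise `q`-th power (the matrix `A^q`). -/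
def matq {F : Type*} [Field F] (q : ℕ) (A : Matrix (Fin 2) (Fin 2) F) :
    Matrix (Fin 2) (Fin 2) F :=
  A.map (· ^ q)

/-- The orbit of a point of `PG(3,q²)` under the group `K ≅ PSL(2,q²)` of projectivities
    induced by the matrices `A^q ⊗ A` with `A ∈ SL(2,𝔽_{q²})`. -/
def Korb {F : Type*} [Field F] (q : ℕ) (P : PGPoint F) : Set (PGPoint F) :=
  {P' | ∃ A : Matrix (Fin 2) (Fin 2) F, A.det = 1 ∧
    ∃ (v : Fin 4 → F) (hv : v ≠ 0) (hw : Matrix.vecMul v (kron (matq q A) A) ≠ 0),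
      P = Projectivization.mk F v hv ∧ P' = Projectivization.mk F _ hw}

/-- The orbit of a point of `PG(3,q²)` under the group `G ≅ PGL(2,q²)` of projectivities
    induced by the matrices `A^q ⊗ A` with `A ∈ GL(2,𝔽_{q²})`. -/
def Gorb {F : Type*} [Field F] (q : ℕ) (P : PGPoint F) : Set (PGPoint F) :=
  {P' | ∃ A : Matrix (Fin 2) (Fin 2) F, A.det ≠ 0 ∧
    ∃ (v : Fin 4 → F) (hv : v ≠ 0) (hw : Matrix.vecMul v (kron (matq q A) A) ≠ 0),
      P = Projectivization.mk F v hv ∧ P' = Projectivization.mk F _ hw}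

/-- The Hermitian Veronese curve `O = {(1,t,t^q,t^{q+1})} ∪ {(0,0,0,1)}`. -/
def Oset (F : Type*) [Field F] (q : ℕ) : Set (PGPoint F) :=
  {P | (∃ (t : F) (hv : ![1, t, t ^ q, t ^ (q + 1)] ≠ 0),
        P = Projectivization.mk F _ hv) ∨
    ∃ (hv : (![0, 0, 0, 1] : Fin 4 → F) ≠ 0), P = Projectivization.mk F _ hv}

/-- The Baer subgeometry `Σ = {(a,b,b^q,c) : a,c ∈ 𝔽_q, b ∈ 𝔽_{q²}}`. -/
def SigmaSet (F : Type*) [Field F] (q : ℕ) : Set (PGPoint F) :=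
  {P | ∃ (a b c : F) (hv : ![a, b, b ^ q, c] ≠ 0),
    a ^ q = a ∧ c ^ q = c ∧ P = Projectivization.mk F _ hv}

/-- The hyperbolic quadric `Q⁺(3,q²) : X₁X₄ − X₂X₃ = 0`. -/
def Qplus (F : Type*) [Field F] : Set (PGPoint F) :=
  {P | ∀ (v : Fin 4 → F) (hv : v ≠ 0), P = Projectivization.mk F v hv →
    v 0 * v 3 - v 1 * v 2 = 0}

/-- A line of `PG(3,q²)`: the set of points lying in a 2-dimensional subspace. -/
def IsLine {F : Type*} [Field F] (ℓ : Set (PGPoint F)) : Prop :=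
  ∃ W : Submodule F (Fin 4 → F), Module.finrank F W = 2 ∧ ℓ = {P | P.rep ∈ W}

/-- A plane of `PG(3,q²)`: the set of points lying in a 3-dimensional subspace. -/
def IsPlane {F : Type*} [Field F] (π : Set (PGPoint F)) : Prop :=
  ∃ W : Submodule F (Fin 4 → F), Module.finrank F W = 3 ∧ π = {P | P.rep ∈ W}

section QuadraticExtension

open scoped Classical

/-- `σ` is the involutory automorphism `x ↦ x ^ q` of a field of odd order `q ^ 2`. -/
structure IsQuadConj {F : Type*} [Field F] [Fintype F] (q : ℕ) (σ : F →+* F) : Prop where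
  card_eq : Fintype.card F = q ^ 2
  apply_eq : ∀ x, σ x = x ^ q
  odd : Odd q

variable {F : Type*} [Field F] [Fintype F]

theorem card_filter_pow_eq_one {m k : ℕ} (h : Fintype.card F - 1 = k * m) :
    (Finset.univ.filter fun x : F => x ^ m = 1).card = m := by
  have hpos : 0 < Fintype.card F - 1 := by
    have := Fintype.one_lt_card (α := F); omega
  have hm : 0 < m := Nat.pos_of_ne_zero (by rintro rfl; omega)
  obtain ⟨g, hg⟩ := IsCyclic.exists_generator (α := Fˣ)
  have ho : orderOf g = Fintype.card F - 1 := by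
    rw [orderOf_eq_card_of_forall_mem_zpowers hg, Nat.card_eq_fintype_card, Fintype.card_units]
  have h1 : IsPrimitiveRoot (g : F) (Fintype.card F - 1) := by
    rw [IsPrimitiveRoot.coe_units_iff, ← ho]; exact IsPrimitiveRoot.orderOf g
  have h2 := h1.pow hpos h
  refine Eq.trans ?_ h2.card_nthRootsFinset
  congr 1
  ext x
  simp [Polynomial.mem_nthRootsFinset hm]

theorem exists_eq_pow_of_pow_eq_one {m k : ℕ} (h : Fintype.card F - 1 = k * m) {x : F}
    (hx : x ^ m = 1) : ∃ y : F, y ≠ 0 ∧ x = y ^ k := by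
  have hpos : 0 < Fintype.card F - 1 := by
    have := Fintype.one_lt_card (α := F); omega
  have hm : 0 < m := Nat.pos_of_ne_zero (by rintro rfl; omega)
  have hx0 : x ≠ 0 := by
    rintro rfl
    simp [hm.ne'] at hx
  obtain ⟨g, hg⟩ := IsCyclic.exists_generator (α := Fˣ)
  have ho : orderOf g = Fintype.card F - 1 := by
    rw [orderOf_eq_card_of_forall_mem_zpowers hg, Nat.card_eq_fintype_card, Fintype.card_units]
  obtain ⟨i, hi⟩ := (mem_powers_iff_mem_zpowers (G := Fˣ)).2 (hg (Units.mk0 x hx0))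
  have hi' : x = (g : F) ^ i := by
    have := congrArg (fun u : Fˣ => (u : F)) hi
    simpa using this.symm
  have h1 : IsPrimitiveRoot (g : F) (Fintype.card F - 1) := by
    rw [IsPrimitiveRoot.coe_units_iff, ← ho]; exact IsPrimitiveRoot.orderOf g
  rw [hi', ← pow_mul, h1.pow_eq_one_iff_dvd, h] at hx
  obtain ⟨l, rfl⟩ := Nat.dvd_of_mul_dvd_mul_right hm hx
  exact ⟨(g : F) ^ l, pow_ne_zero _ g.ne_zero, by rw [hi', ← pow_mul, mul_comm l]⟩

namespace IsQuadConj

variable {q : ℕ} {σ : F →+* F} (h : IsQuadConj q σ)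
include h

theorem three_le : 3 ≤ q := by
  obtain ⟨k, hk⟩ := h.odd
  have h1 := Fintype.one_lt_card (α := F)
  rw [h.card_eq] at h1
  rcases k with _ | k
  · simp [hk] at h1
  · omega

theorem card_sub_one : Fintype.card F - 1 = (q - 1) * (q + 1) := by
  obtain ⟨k, hk⟩ : ∃ k, q = k + 1 := ⟨q - 1, by have := h.three_le; omega⟩
  rw [h.card_eq, hk]
  simp
  ring_nf
  omega

theorem involutive (x : F) : σ (σ x) = x := by
  rw [h.apply_eq, h.apply_eq, ← pow_mul, ← sq, ← h.card_eq, FiniteField.pow_card]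

theorem ringChar_ne_two : ringChar F ≠ 2 := by
  intro hc
  have h1 := FiniteField.even_card_iff_char_two.1 hc
  have h2 : q ^ 2 % 2 = 1 := Nat.odd_iff.1 h.odd.pow
  rw [h.card_eq, h2] at h1
  exact one_ne_zero h1

theorem two_ne_zero : (2 : F) ≠ 0 := Ring.two_ne_zero h.ringChar_ne_two

theorem norm_eq (x : F) : x ^ (q + 1) = x * σ x := by
  rw [h.apply_eq, pow_succ, mul_comm]

theorem norm_fixed (x : F) : σ (x * σ x) = x * σ x := by
  rw [map_mul, h.involutive, mul_comm]

theorem trace_fixed (x : F) : σ (x + σ x) = x + σ x := by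
  rw [map_add, h.involutive, add_comm]

theorem fixed_iff {x : F} (hx : x ≠ 0) : σ x = x ↔ x ^ (q - 1) = 1 := by
  have hq : q = (q - 1) + 1 := by have := h.three_le; omega
  rw [h.apply_eq]
  nth_rw 1 [hq]
  rw [pow_succ]
  exact mul_eq_right₀ hx

theorem card_fixed : (Finset.univ.filter fun x : F => σ x = x).card = q := by
  have h1 : (Finset.univ.filter fun x : F => σ x = x)
      = insert 0 (Finset.univ.filter fun x : F => x ^ (q - 1) = 1) := by
    ext x
    by_cases hx : x = 0
    · simp [hx]
    · simp [hx, h.fixed_iff hx]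
  have h3 := h.three_le
  rw [h1, Finset.card_insert_of_notMem, card_filter_pow_eq_one (k := q + 1)]
  · omega
  · rw [h.card_sub_one, mul_comm]
  · simp [zero_pow (show q - 1 ≠ 0 by omega)]

theorem exists_norm_eq {n : F} (hn : n ≠ 0) (hn' : σ n = n) : ∃ x : F, x ≠ 0 ∧ x * σ x = n := by
  obtain ⟨y, hy0, hy⟩ := exists_eq_pow_of_pow_eq_one (m := q - 1) (k := q + 1)
    (by rw [h.card_sub_one, mul_comm]) ((h.fixed_iff hn).1 hn')
  exact ⟨y, hy0, by rw [hy, h.norm_eq]⟩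

theorem card_norm_fiber {n : F} (hn : n ≠ 0) (hn' : σ n = n) :
    (Finset.univ.filter fun x : F => x * σ x = n).card = q + 1 := by
  obtain ⟨x0, hx0, hx⟩ := h.exists_norm_eq hn hn'
  rw [← card_filter_pow_eq_one (F := F) (m := q + 1) (k := q - 1) h.card_sub_one]
  refine Finset.card_bij' (fun x _ => x / x0) (fun x _ => x * x0) ?_ ?_ ?_ ?_
  · intro x hx'
    simp only [Finset.mem_filter, Finset.mem_univ, true_and] at hx' ⊢
    rw [h.norm_eq, map_div₀, div_mul_div_comm, hx', hx, div_self hn]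
  · intro x hx'
    simp only [Finset.mem_filter, Finset.mem_univ, true_and] at hx' ⊢
    rw [h.norm_eq] at hx'
    rw [map_mul, mul_mul_mul_comm, hx', hx, one_mul]
  · intro x _; field_simp
  · intro x _; field_simp

omit [Fintype F] h in
theorem norm_eq_zero {x : F} : x * σ x = 0 ↔ x = 0 := by
  simp

/-- Summing over norms. -/
theorem sum_norm {M : Type*} [AddCommMonoid M] (f : F → M) :
    ∑ x : F, f (x * σ x)
      = f 0 + (q + 1) • ∑ n ∈ Finset.univ.filter (fun n : F => σ n = n ∧ n ≠ 0), f n := by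
  rw [← Finset.sum_filter_add_sum_filter_not Finset.univ (fun x : F => x = 0)]
  congr 1
  · rw [Finset.filter_eq' Finset.univ (0 : F)]; simp
  · rw [Finset.smul_sum, ← Finset.sum_fiberwise_of_maps_to
      (t := Finset.univ.filter (fun n : F => σ n = n ∧ n ≠ 0)) (g := fun x => x * σ x)]
    · refine Finset.sum_congr rfl fun n hn => ?_
      simp only [Finset.mem_filter, Finset.mem_univ, true_and] at hn
      rw [← h.card_norm_fiber hn.2 hn.1, ← Finset.sum_const]
      refine Finset.sum_congr ?_ ?_
      · ext x
        simp only [Finset.mem_filter, Finset.mem_univ, true_and]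
        refine ⟨fun hx => hx.2, fun hx => ⟨?_, hx⟩⟩
        rintro rfl
        simp at hx
        exact hn.2 hx.symm
      · intro x hx
        simp only [Finset.mem_filter, Finset.mem_univ, true_and] at hx
        rw [hx]
    · intro x hx
      simp only [Finset.mem_filter, Finset.mem_univ, true_and] at hx ⊢
      exact ⟨h.norm_fixed x, fun h0 => hx (norm_eq_zero.1 h0)⟩

theorem exists_trace_eq_one : ∃ t : F, t + σ t = 1 := by
  refine ⟨2⁻¹, ?_⟩
  have := h.two_ne_zero
  rw [map_inv₀, map_ofNat]
  field_simp
  norm_num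

variable {e : AddChar F ℂ}

theorem sum_trace (he : e 1 ≠ 1) (β : F) :
    ∑ t : F, e (β * t + σ (β * t)) = if β = 0 then (q : ℂ) ^ 2 else 0 := by
  split_ifs with hβ
  · simp [hβ, h.card_eq]
  · obtain ⟨t0, ht0⟩ := h.exists_trace_eq_one
    have key : e 1 * ∑ t : F, e (β * t + σ (β * t)) = ∑ t : F, e (β * t + σ (β * t)) := by
      rw [Finset.mul_sum]
      conv_rhs => rw [← Equiv.sum_comp (Equiv.addRight (t0 / β))]
      refine Finset.sum_congr rfl fun t _ => ?_
      rw [← AddChar.map_add_eq_mul]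
      congr 1
      simp only [Equiv.coe_addRight]
      rw [mul_add, mul_div_cancel₀ _ hβ, map_add, ← ht0]
      ring
    have : (e 1 - 1) * ∑ t : F, e (β * t + σ (β * t)) = 0 := by
      rw [sub_mul, key]; ring
    exact (mul_eq_zero.1 this).resolve_left (sub_ne_zero.2 he)

omit h in
theorem sum_fixed (he : e 1 ≠ 1) {a : F} (ha : σ a = a) (ha0 : a ≠ 0) :
    ∑ n ∈ Finset.univ.filter (fun n : F => σ n = n), e (a * n) = 0 := by
  have key : e 1 * ∑ n ∈ Finset.univ.filter (fun n : F => σ n = n), e (a * n)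
      = ∑ n ∈ Finset.univ.filter (fun n : F => σ n = n), e (a * n) := by
    rw [Finset.mul_sum]
    refine Finset.sum_bij' (fun n _ => n + a⁻¹) (fun n _ => n - a⁻¹) ?_ ?_ ?_ ?_ ?_
    · intro n hn
      simp only [Finset.mem_filter, Finset.mem_univ, true_and] at hn ⊢
      rw [map_add, map_inv₀, ha, hn]
    · intro n hn
      simp only [Finset.mem_filter, Finset.mem_univ, true_and] at hn ⊢
      rw [map_sub, map_inv₀, ha, hn]
    · intro n _; ring
    · intro n _; ring
    · intro n _
      rw [← AddChar.map_add_eq_mul]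
      congr 1
      field_simp
      ring
  have : (e 1 - 1) * ∑ n ∈ Finset.univ.filter (fun n : F => σ n = n), e (a * n) = 0 := by
    rw [sub_mul, key]; ring
  exact (mul_eq_zero.1 this).resolve_left (sub_ne_zero.2 he)

theorem sum_mul_norm (he : e 1 ≠ 1) {a : F} (ha : σ a = a) :
    ∑ t : F, e (a * (t * σ t)) = if a = 0 then (q : ℂ) ^ 2 else -q := by
  split_ifs with ha0
  · simp [ha0, h.card_eq]
  · rw [h.sum_norm fun n => e (a * n)]
    have h1 := sum_fixed he ha ha0
    have h2 : (Finset.univ.filter fun n : F => σ n = n)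
        = insert 0 (Finset.univ.filter fun n : F => σ n = n ∧ n ≠ 0) := by
      ext x
      by_cases hx : x = 0 <;> simp [hx]
    rw [h2, Finset.sum_insert (by simp)] at h1
    simp only [mul_zero, AddChar.map_zero_eq_one, nsmul_eq_mul] at h1 ⊢
    push_cast
    linear_combination ((q : ℂ) + 1) * h1

/-- Gaussian sums of inhomogeneous Hermitian forms in one variable. -/
theorem sum_norm_add_trace (he : e 1 ≠ 1) {a : F} (ha : σ a = a) (ha0 : a ≠ 0) (β c : F) :
    ∑ t : F, e (a * (t * σ t) + (β * t + σ (β * t)) + c) = -q * e (c - β * σ β / a) := by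
  rw [← Equiv.sum_comp (Equiv.subRight (σ β / a))]
  have h1 : ∀ t : F, e (a * (Equiv.subRight (σ β / a) t * σ (Equiv.subRight (σ β / a) t))
      + (β * Equiv.subRight (σ β / a) t + σ (β * Equiv.subRight (σ β / a) t)) + c)
      = e (a * (t * σ t)) * e (c - β * σ β / a) := by
    intro t
    rw [← AddChar.map_add_eq_mul]
    congr 1
    simp only [Equiv.subRight_apply, map_sub, map_div₀, map_mul, h.involutive, ha]
    field_simp
    ring
  rw [Finset.sum_congr rfl fun t _ => h1 t, ← Finset.sum_mul, h.sum_mul_norm he ha, if_neg ha0]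

end IsQuadConj
end QuadraticExtension

section HermitianSums

open scoped Classical

variable {F : Type*} [Field F] [Fintype F]

/-- The binary Hermitian form with coefficients `a, b, d`. -/
def hermForm (σ : F →+* F) (a b d u v : F) : F :=
  a * (u * σ u) + (b * (σ u * v) + σ (b * (σ u * v))) + d * (v * σ v)

/-- The Gaussian sum of a binary Hermitian form with linear term `(α, β)`. -/
def hermSum (σ : F →+* F) (e : AddChar F ℂ) (a b d α β : F) : ℂ :=
  ∑ v : F, ∑ u : F, e (hermForm σ a b d u v + (α * u + β * v + σ (α * u + β * v)))

namespace IsQuadConj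

variable {q : ℕ} {σ : F →+* F} (h : IsQuadConj q σ) {e : AddChar F ℂ} (he : e 1 ≠ 1)
include h he

theorem sum_trace_add (β c : F) :
    ∑ t : F, e (c + (β * t + σ (β * t))) = if β = 0 then (q : ℂ) ^ 2 * e c else 0 := by
  simp_rw [AddChar.map_add_eq_mul e c, ← Finset.mul_sum, h.sum_trace he]
  split_ifs <;> ring

theorem hermSum_inner {a : F} (ha : σ a = a) (ha0 : a ≠ 0) (b d α β : F) :
    hermSum σ e a b d α β = -q * ∑ v : F, e ((a * d - b * σ b) / a * (v * σ v)
      + ((β - b * α / a) * v + σ ((β - b * α / a) * v)) + -(α * σ α / a)) := by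
  rw [hermSum, Finset.mul_sum]
  refine Finset.sum_congr rfl fun v _ => ?_
  have h1 := h.sum_norm_add_trace he ha ha0 (σ b * σ v + α)
    (d * (v * σ v) + (β * v + σ (β * v)))
  refine Eq.trans (Finset.sum_congr rfl fun u _ => ?_) (h1.trans ?_)
  · congr 1
    simp only [hermForm, map_add, map_mul, h.involutive]
    ring
  · congr 2
    simp only [map_add, map_sub, map_div₀, map_mul, h.involutive, ha]
    field_simp
    ring

theorem hermSum_of_ne_zero {a b d : F} (ha : σ a = a) (hd : σ d = d)
    (hδ : a * d - b * σ b ≠ 0) (α β : F) :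
    hermSum σ e a b d α β = q ^ 2 * e (-((d * (α * σ α) + a * (β * σ β)
      - (σ b * (β * σ α) + σ (σ b * (β * σ α)))) / (a * d - b * σ b))) := by
  by_cases ha0 : a = 0
  · subst ha0
    have hb : b ≠ 0 := by
      rintro rfl
      simp at hδ
    have hb' : σ b ≠ 0 := by simpa using hb
    rw [hermSum, Finset.sum_eq_single (-(σ α / b))]
    · have h1 := h.sum_trace_add he (0 : F) (d * (α * σ α) / (b * σ b)
        + -(β * σ α / b + σ (β * σ α / b)))
      rw [if_pos rfl] at h1
      refine Eq.trans (Finset.sum_congr rfl fun u _ => ?_) (h1.trans ?_)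
      · congr 1
        simp only [hermForm, map_add, map_mul, map_neg, map_div₀, h.involutive, map_zero]
        field_simp
        ring
      · congr 2
        simp only [map_mul, map_div₀, h.involutive]
        field_simp
        ring
    · intro v _ hv
      have h1 := h.sum_trace_add he (σ b * σ v + α) (d * (v * σ v) + (β * v + σ (β * v)))
      rw [if_neg] at h1
      · refine Eq.trans (Finset.sum_congr rfl fun u _ => ?_) h1
        congr 1
        simp only [hermForm, map_add, map_mul, h.involutive]
        ring
      · intro h0
        apply hv
        have h2 := congrArg σ h0
        simp only [map_add, map_mul, h.involutive, map_zero] at h2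
        field_simp
        linear_combination h2
    · simp
  · rw [h.hermSum_inner he ha ha0]
    have h2 : (a * d - b * σ b) / a ≠ 0 := div_ne_zero hδ ha0
    have h3 : σ ((a * d - b * σ b) / a) = (a * d - b * σ b) / a := by
      rw [map_div₀, map_sub, map_mul, h.norm_fixed, ha, hd]
    rw [h.sum_norm_add_trace he h3 h2, ← mul_assoc]
    congr 1
    · ring
    · congr 1
      simp only [map_sub, map_div₀, map_mul, h.involutive, ha]
      field_simp
      ring

theorem hermSum_of_eq_zero {a b d : F} (ha : σ a = a) (ha0 : a ≠ 0)
    (hδ : a * d - b * σ b = 0) (α β : F) :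
    hermSum σ e a b d α β = if β = b * α / a then -(q : ℂ) ^ 3 * e (-(α * σ α / a)) else 0 := by
  rw [h.hermSum_inner he ha ha0, hδ]
  have h1 := h.sum_trace_add he (β - b * α / a) (-(α * σ α / a))
  rw [show (∑ v : F, e (0 / a * (v * σ v)
      + ((β - b * α / a) * v + σ ((β - b * α / a) * v)) + -(α * σ α / a))) = _ from
    Eq.trans (Finset.sum_congr rfl fun v _ => by congr 1; ring) h1]
  simp only [sub_eq_zero]
  split_ifs <;> ring

theorem hermSum_of_left_eq_zero (d α β : F) :
    hermSum σ e 0 0 d α β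
      = if α = 0 then (q : ℂ) ^ 2 * ∑ v : F, e (d * (v * σ v) + (β * v + σ (β * v))) else 0 := by
  have h1 : ∀ v : F, ∑ u : F, e (hermForm σ 0 0 d u v + (α * u + β * v + σ (α * u + β * v)))
      = if α = 0 then (q : ℂ) ^ 2 * e (d * (v * σ v) + (β * v + σ (β * v))) else 0 := by
    intro v
    rw [← h.sum_trace_add he]
    refine Finset.sum_congr rfl fun u _ => ?_
    congr 1
    simp only [hermForm, map_add, map_mul, map_zero]
    ring
  rw [hermSum, Finset.sum_congr rfl fun v _ => h1 v]
  split_ifs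
  · rw [Finset.mul_sum]
  · simp

theorem hermSum_zero_of_eq_zero {a b d : F} (ha : σ a = a) (hd : σ d = d)
    (hδ : a * d - b * σ b = 0) : ∃ z : ℤ, hermSum σ e a b d 0 0 = q ^ 3 * z := by
  by_cases ha0 : a = 0
  · subst ha0
    have hb : b = 0 := by simpa using hδ
    subst hb
    rw [h.hermSum_of_left_eq_zero he, if_pos rfl]
    have h1 : ∑ v : F, e (d * (v * σ v) + (0 * v + σ (0 * v))) = ∑ v : F, e (d * (v * σ v)) := by
      simp
    rw [h1, h.sum_mul_norm he hd]
    split_ifs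
    · exact ⟨q, by push_cast; ring⟩
    · exact ⟨-1, by push_cast; ring⟩
  · rw [h.hermSum_of_eq_zero he ha ha0 hδ]
    exact ⟨-1, by simp⟩

omit [Fintype F] h he in
theorem hermForm_sub_smul {k : F} (hk : σ k = k) (a b d a' b' d' u v : F) :
    hermForm σ a' b' d' u v - k * hermForm σ a b d u v
      = hermForm σ (a' - k * a) (b' - k * b) (d' - k * d) u v := by
  simp only [hermForm, map_sub, map_mul, hk]
  ring

/-- The exponential sum attached to two Hermitian forms coupled by `x` times the determinant. -/
theorem sum_hermForm_hermSum {a b d a' b' d' x : F} (ha : σ a = a) (hd : σ d = d)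
    (ha' : σ a' = a') (hd' : σ d' = d') (hx : x ≠ 0) {R : F}
    (hR : R = (x * σ x) ^ 2 - x * σ x * (a * d' + a' * d - b * σ b' - σ b * b')
      + (a * d - b * σ b) * (a' * d' - b' * σ b')) :
    (R ≠ 0 → ∑ v : F, ∑ u : F, e (hermForm σ a' b' d' u v)
        * hermSum σ e a b d (-(x * v)) (x * u) = q ^ 4) ∧
    (R = 0 → ∃ z : ℤ, ∑ v : F, ∑ u : F, e (hermForm σ a' b' d' u v)
        * hermSum σ e a b d (-(x * v)) (x * u) = q ^ 5 * z) := by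
  have hx' : σ x ≠ 0 := by simpa using hx
  have hn0 : x * σ x ≠ 0 := mul_ne_zero hx hx'
  have hn := h.norm_fixed x
  by_cases hδ : a * d - b * σ b = 0
  · by_cases ha0 : a = 0
    · subst ha0
      have hb : b = 0 := by simpa using hδ
      subst hb
      have h1 : ∀ u v : F, e (hermForm σ a' b' d' u v) * hermSum σ e 0 0 d (-(x * v)) (x * u)
          = if v = 0 then q ^ 2 * (e (a' * (u * σ u))
            * ∑ w : F, e (d * (w * σ w) + (x * u * w + σ (x * u * w)))) else 0 := by
        intro u v
        rw [h.hermSum_of_left_eq_zero he]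
        by_cases hv : v = 0
        · subst hv
          rw [if_pos (by simp), if_pos rfl]
          simp only [hermForm, mul_zero, map_zero, add_zero]
          ring
        · rw [if_neg (by simp [hv, hx]), if_neg hv, mul_zero]
      simp_rw [h1]
      rw [Finset.sum_eq_single 0 (by intro v _ hv; simp [hv]) (by simp)]
      simp only [if_true]
      by_cases hd0 : d = 0
      · subst hd0
        have h2 : ∀ u : F, ∑ w : F, e (0 * (w * σ w) + (x * u * w + σ (x * u * w)))
            = if u = 0 then (q : ℂ) ^ 2 else 0 := by
          intro u
          have h3 := h.sum_trace_add he (x * u) 0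
          simp only [mul_eq_zero, hx, false_or, e.map_zero_eq_one, mul_one] at h3
          rw [← h3]
          simp
        simp_rw [h2]
        rw [Finset.sum_eq_single 0 (by intro u _ hu; simp [hu]) (by simp)]
        refine ⟨fun _ => ?_, fun hR0 => absurd hR0 ?_⟩
        · simp
          ring
        · rw [hR]
          simp [hx]
      · have hc : σ (a' - x * σ x / d) = a' - x * σ x / d := by
          rw [map_sub, map_div₀, ha', hn, hd]
        have h2 : ∀ u : F, e (a' * (u * σ u))
            * ∑ w : F, e (d * (w * σ w) + (x * u * w + σ (x * u * w)))
            = -q * e ((a' - x * σ x / d) * (u * σ u)) := by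
          intro u
          have h3 := h.sum_norm_add_trace he hd hd0 (x * u) 0
          simp only [add_zero] at h3
          rw [h3, mul_left_comm, ← AddChar.map_add_eq_mul]
          congr 2
          simp only [map_mul]
          ring
        simp_rw [h2]
        rw [← Finset.mul_sum, ← Finset.mul_sum, h.sum_mul_norm he hc]
        have hRc : R = -(x * σ x) * d * (a' - x * σ x / d) := by
          rw [hR]
          simp only [map_zero]
          field_simp
          ring
        refine ⟨fun hR0 => ?_, fun hR0 => ⟨-1, ?_⟩⟩
        · rw [if_neg (by rintro h0; rw [h0, mul_zero] at hRc; exact hR0 hRc)]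
          ring
        · rw [if_pos]
          · push_cast; ring
          · rw [hRc] at hR0
            exact (mul_eq_zero.1 hR0).resolve_left (mul_ne_zero (neg_ne_zero.2 hn0) hd0)
    · set c := (a * d' + a' * d - b * σ b' - σ b * b' - x * σ x) / a with hcdef
      have hc : σ c = c := by
        simp only [hcdef, map_div₀, map_sub, map_add, map_mul, h.involutive, ha, ha', hd, hd']
        ring
      have h1 : ∀ v : F, ∑ u : F, e (hermForm σ a' b' d' u v)
          * hermSum σ e a b d (-(x * v)) (x * u) = -q ^ 3 * e (c * (v * σ v)) := by
        intro v
        rw [Finset.sum_eq_single (-(b * v / a))]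
        · rw [h.hermSum_of_eq_zero he ha ha0 hδ, if_pos (by ring), mul_left_comm,
            ← AddChar.map_add_eq_mul]
          congr 2
          simp only [hcdef, hermForm, map_mul, map_neg, map_div₀, ha, h.involutive]
          field_simp
          linear_combination (-(v * σ v * a')) * hδ
        · intro u _ hu
          rw [h.hermSum_of_eq_zero he ha ha0 hδ, if_neg, mul_zero]
          intro h0
          apply hu
          have h2 : x * (u + b * v / a) = 0 := by rw [mul_add, h0]; ring
          exact eq_neg_of_add_eq_zero_left ((mul_eq_zero.1 h2).resolve_left hx)
        · simp
      simp_rw [h1]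
      rw [← Finset.mul_sum, h.sum_mul_norm he hc]
      have hRc : R = -(x * σ x) * a * c := by
        rw [hR, hδ, hcdef]
        field_simp
        ring
      refine ⟨fun hR0 => ?_, fun hR0 => ⟨-1, ?_⟩⟩
      · rw [if_neg (by rintro h0; rw [h0, mul_zero] at hRc; exact hR0 hRc)]
        ring
      · rw [if_pos]
        · push_cast; ring
        · rw [hRc] at hR0
          exact (mul_eq_zero.1 hR0).resolve_left (mul_ne_zero (neg_ne_zero.2 hn0) ha0)
  · set k := x * σ x / (a * d - b * σ b) with hkdef
    have hk : σ k = k := by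
      simp only [hkdef, map_div₀, map_sub, map_mul, h.involutive, ha, hd]
      ring
    have h1 : ∀ u v : F, e (hermForm σ a' b' d' u v) * hermSum σ e a b d (-(x * v)) (x * u)
        = q ^ 2 * e (hermForm σ (a' - k * a) (b' - k * b) (d' - k * d) u v
          + (0 * u + 0 * v + σ (0 * u + 0 * v))) := by
      intro u v
      rw [h.hermSum_of_ne_zero he ha hd hδ, mul_left_comm, ← AddChar.map_add_eq_mul]
      congr 2
      rw [← hermForm_sub_smul hk]
      simp only [hkdef, hermForm, map_neg, map_add, map_mul, map_zero, h.involutive]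
      field_simp
      ring
    simp_rw [h1, ← Finset.mul_sum]
    change (R ≠ 0 → (q : ℂ) ^ 2 * hermSum σ e (a' - k * a) (b' - k * b) (d' - k * d) 0 0 = _) ∧
      (R = 0 → ∃ z : ℤ,
        (q : ℂ) ^ 2 * hermSum σ e (a' - k * a) (b' - k * b) (d' - k * d) 0 0 = _)
    have ha'' : σ (a' - k * a) = a' - k * a := by rw [map_sub, map_mul, ha, ha', hk]
    have hd'' : σ (d' - k * d) = d' - k * d := by rw [map_sub, map_mul, hd, hd', hk]
    have hRk : R = (a * d - b * σ b)
        * ((a' - k * a) * (d' - k * d) - (b' - k * b) * σ (b' - k * b)) := by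
      rw [hR, map_sub, map_mul, hk, hkdef]
      field_simp
      ring
    refine ⟨fun hR0 => ?_, fun hR0 => ?_⟩
    · rw [h.hermSum_of_ne_zero he ha'' hd'' (by rintro h0; rw [h0, mul_zero] at hRk; exact hR0 hRk)]
      simp
      ring
    · rw [hRk] at hR0
      obtain ⟨z, hz⟩ :=
        h.hermSum_zero_of_eq_zero he ha'' hd'' ((mul_eq_zero.1 hR0).resolve_left hδ)
      exact ⟨z, by rw [hz]; ring⟩

end IsQuadConj
end HermitianSums

section QuadraticCharacterSums

open scoped Classical

variable {F : Type*} [Field F] [Fintype F]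

/-- The sum of the quadratic character over the elements of norm `r`. -/
def normCharSum (σ : F →+* F) (r : F) : ℤ :=
  ∑ x : F, if x * σ x = r then quadraticChar F x else 0

namespace IsQuadConj

variable {q : ℕ} {σ : F →+* F} (h : IsQuadConj q σ)

theorem normCharSum_zero : normCharSum σ 0 = 0 := by
  refine Finset.sum_eq_zero fun x _ => ?_
  split_ifs with hx
  · rw [norm_eq_zero.1 hx, MulChar.map_zero]
  · rfl

include h

theorem sum_normCharSum :
    ∑ r ∈ Finset.univ.filter (fun r : F => σ r = r), normCharSum σ r = 0 := by
  simp only [normCharSum]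
  refine Eq.trans ?_ (quadraticChar_sum_zero h.ringChar_ne_two)
  rw [Finset.sum_comm]
  refine Finset.sum_congr rfl fun x _ => ?_
  rw [Finset.sum_ite_eq, if_pos]
  simpa using (h.norm_fixed x)

theorem sum_normCharSum_affine {a b : F} (ha : σ a = a) (hb : σ b = b) (hb0 : b ≠ 0) :
    ∑ s ∈ Finset.univ.filter (fun r : F => σ r = r), normCharSum σ (a + s * b) = 0 := by
  rw [← h.sum_normCharSum]
  refine Finset.sum_bij' (fun s _ => a + s * b) (fun r _ => (r - a) / b) ?_ ?_ ?_ ?_ ?_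
  · intro s hs
    simp only [Finset.mem_filter, Finset.mem_univ, true_and] at hs ⊢
    rw [map_add, map_mul, ha, hb, hs]
  · intro s hs
    simp only [Finset.mem_filter, Finset.mem_univ, true_and] at hs ⊢
    rw [map_div₀, map_sub, ha, hb, hs]
  · intro s _; field_simp; ring
  · intro s _; field_simp; ring
  · intro s _; rfl

theorem dvd_sum_comp_sub_conj (f : F → ℤ) : (q : ℤ) ∣ ∑ y : F, f (y - σ y) := by
  rw [← Finset.sum_fiberwise Finset.univ (fun y : F => y - σ y)]
  refine Finset.dvd_sum fun z _ => ?_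
  have h1 : ∑ y ∈ Finset.univ.filter (fun y : F => y - σ y = z), f (y - σ y)
      = ∑ y ∈ Finset.univ.filter (fun y : F => y - σ y = z), f z :=
    Finset.sum_congr rfl fun y hy => by rw [(Finset.mem_filter.1 hy).2]
  rw [h1, Finset.sum_const, nsmul_eq_mul]
  by_cases hz : ∃ y0 : F, y0 - σ y0 = z
  · obtain ⟨y0, hy0⟩ := hz
    have h2 : (Finset.univ.filter fun y : F => y - σ y = z).card = q := by
      rw [← h.card_fixed]
      refine Finset.card_bij' (fun y _ => y - y0) (fun y _ => y + y0) ?_ ?_ ?_ ?_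
      · intro y hy
        simp only [Finset.mem_filter, Finset.mem_univ, true_and] at hy ⊢
        rw [map_sub]
        linear_combination hy0 - hy
      · intro y hy
        simp only [Finset.mem_filter, Finset.mem_univ, true_and] at hy ⊢
        rw [map_add]
        linear_combination hy0 - hy
      · intro y _; ring
      · intro y _; ring
    rw [h2]
    exact dvd_mul_right _ _
  · rw [Finset.filter_eq_empty_iff.2 fun y _ hy => hz ⟨y, hy⟩]
    simp

theorem dvd_sum_normCharSum_one (β : F) :
    (q : ℤ) ∣ ∑ y : F, normCharSum σ ((y - σ y) * (β * y - σ (β * y))) := by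
  by_cases hβ : σ β = β
  · simp_rw [map_mul, hβ, ← mul_sub]
    exact h.dvd_sum_comp_sub_conj fun z => normCharSum σ (z * (β * z))
  · have hq0 : (q : ℤ) ≠ 0 := by have := h.three_le; positivity
    suffices h0 : (q : ℤ) * ∑ y : F, normCharSum σ ((y - σ y) * (β * y - σ (β * y))) = 0 by
      rw [(mul_eq_zero.1 h0).resolve_left hq0]
      exact dvd_zero _
    have h1 : ∀ s ∈ Finset.univ.filter (fun r : F => σ r = r),
        ∑ y : F, normCharSum σ ((y - σ y) * (β * y - σ (β * y))) =
        ∑ y : F, normCharSum σ ((y - σ y) * (β * y - σ (β * y))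
          + s * ((y - σ y) * (β - σ β))) := by
      intro s hs
      rw [← Equiv.sum_comp (Equiv.addRight s)]
      refine Finset.sum_congr rfl fun y _ => ?_
      have hs' : σ s = s := (Finset.mem_filter.1 hs).2
      congr 1
      simp only [Equiv.coe_addRight, map_add, map_mul, hs']
      ring
    rw [← nsmul_eq_mul, ← h.card_fixed, ← Finset.sum_const, Finset.sum_congr rfl h1,
      Finset.sum_comm]
    refine Finset.sum_eq_zero fun y _ => ?_
    by_cases hy : y - σ y = 0
    · simp [hy, normCharSum_zero]
    · refine h.sum_normCharSum_affine ?_ ?_ (mul_ne_zero hy (sub_ne_zero.2 (Ne.symm hβ)))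
      · simp only [map_sub, map_mul, h.involutive]
        ring
      · simp only [map_sub, map_mul, h.involutive]
        ring

theorem dvd_sum_normCharSum (α β : F) :
    (q : ℤ) ∣ ∑ y : F, normCharSum σ ((α * y - σ (α * y)) * (β * y - σ (β * y))) := by
  by_cases hα : α = 0
  · simp [hα, normCharSum_zero]
  · rw [← Equiv.sum_comp (Equiv.mulLeft₀ α⁻¹ (inv_ne_zero hα))]
    have h1 := h.dvd_sum_normCharSum_one (β / α)
    refine h1.trans (dvd_of_eq (Finset.sum_congr rfl fun y _ => ?_))
    have h2 : α * (α⁻¹ * y) = y := by field_simp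
    have h3 : β * (α⁻¹ * y) = β / α * y := by field_simp
    simp only [Equiv.mulLeft₀_apply, h2, h3]

/-- The binary discriminant form of a pencil of Hermitian forms. -/
theorem dvd_sum_resultant {θ d H : F} (hθ : σ θ ≠ θ) (hH : σ H = H) :
    (q : ℤ) ∣ ∑ y : F, ∑ x : F,
      if (x * σ x) ^ 2 - x * σ x * (2 * d * θ * y ^ 2 + H * (θ + σ θ) * (y * σ y)
          + 2 * σ d * σ θ * σ y ^ 2)
        + (d * y ^ 2 + H * (y * σ y) + σ d * σ y ^ 2)
          * (d * (y * θ) ^ 2 + H * (y * θ * σ (y * θ)) + σ d * σ (y * θ) ^ 2) = 0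
      then quadraticChar F x else 0 := by
  by_cases hy0 : ∃ y0 : F, y0 ≠ 0 ∧ d * y0 ^ 2 + H * (y0 * σ y0) + σ d * σ y0 ^ 2 = 0
  · obtain ⟨y0, hy0, hδ⟩ := hy0
    rw [← Equiv.sum_comp (Equiv.mulLeft₀ y0 hy0)]
    set c := d * y0 ^ 2 with hc
    have hN : H * (y0 * σ y0) = -c - σ c := by
      rw [hc, map_mul, map_pow]
      linear_combination hδ
    set r1 : F → F := fun y => (1 * y - σ (1 * y)) * (c * θ * y - σ (c * θ * y)) with hr1
    set r2 : F → F := fun y => (c * y - σ (c * y)) * (θ * y - σ (θ * y)) with hr2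
    have h12 : ∀ y, r1 y - r2 y = y * σ y * (σ c - c) * (θ - σ θ) := by
      intro y
      simp only [hr1, hr2, map_mul, map_one]
      ring
    have hfac : ∀ x y : F, (x * σ x) ^ 2 - x * σ x * (2 * d * θ * (y0 * y) ^ 2
          + H * (θ + σ θ) * (y0 * y * σ (y0 * y)) + 2 * σ d * σ θ * σ (y0 * y) ^ 2)
        + (d * (y0 * y) ^ 2 + H * (y0 * y * σ (y0 * y)) + σ d * σ (y0 * y) ^ 2)
          * (d * (y0 * y * θ) ^ 2 + H * (y0 * y * θ * σ (y0 * y * θ))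
            + σ d * σ (y0 * y * θ) ^ 2)
        = (x * σ x - r1 y) * (x * σ x - r2 y) := by
      intro x y
      have hcσ : σ c = σ d * σ y0 ^ 2 := by rw [hc, map_mul, map_pow]
      have e1 : 2 * d * θ * (y0 * y) ^ 2 + H * (θ + σ θ) * (y0 * y * σ (y0 * y))
          + 2 * σ d * σ θ * σ (y0 * y) ^ 2 = r1 y + r2 y := by
        simp only [hr1, hr2, map_mul, map_one]
        linear_combination (θ + σ θ) * y * σ y * hN - 2 * θ * y ^ 2 * hc - 2 * σ θ * σ y ^ 2 * hcσ
      have e2 : (d * (y0 * y) ^ 2 + H * (y0 * y * σ (y0 * y)) + σ d * σ (y0 * y) ^ 2)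
          = (y - σ y) * (c * y - σ c * σ y) := by
        simp only [map_mul]
        linear_combination y * σ y * hN - y ^ 2 * hc - σ y ^ 2 * hcσ
      have e3 : (d * (y0 * y * θ) ^ 2 + H * (y0 * y * θ * σ (y0 * y * θ))
            + σ d * σ (y0 * y * θ) ^ 2)
          = (θ * y - σ θ * σ y) * (c * θ * y - σ c * σ θ * σ y) := by
        simp only [map_mul]
        linear_combination y * σ y * θ * σ θ * hN - θ ^ 2 * y ^ 2 * hc - σ θ ^ 2 * σ y ^ 2 * hcσ
      rw [e1, e2, e3]
      simp only [hr1, hr2, map_mul, map_one]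
      ring
    simp only [Equiv.mulLeft₀_apply, hfac]
    by_cases hcc : σ c = c
    · refine (h.dvd_sum_normCharSum 1 (c * θ)).trans
        (dvd_of_eq (Finset.sum_congr rfl fun y _ => Finset.sum_congr rfl fun x _ => ?_))
      have h3 : r2 y = r1 y := by
        have := h12 y
        rw [hcc, sub_self, mul_zero, zero_mul] at this
        exact (sub_eq_zero.1 this).symm
      rw [h3, mul_self_eq_zero, sub_eq_zero]
    · refine ((h.dvd_sum_normCharSum 1 (c * θ)).add (h.dvd_sum_normCharSum c θ)).trans
        (dvd_of_eq ?_)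
      rw [← Finset.sum_add_distrib]
      refine Finset.sum_congr rfl fun y _ => ?_
      rw [normCharSum, normCharSum, ← Finset.sum_add_distrib]
      refine Finset.sum_congr rfl fun x _ => ?_
      change (if x * σ x = r1 y then _ else _) + (if x * σ x = r2 y then _ else _) = _
      simp only [mul_eq_zero, sub_eq_zero]
      by_cases h1 : x * σ x = r1 y
      · by_cases h2 : x * σ x = r2 y
        · have h4 := h12 y
          rw [← h1, ← h2, sub_self] at h4
          have hy : y = 0 := by
            have h5 : σ c - c ≠ 0 := sub_ne_zero.2 hcc
            have h6 : θ - σ θ ≠ 0 := sub_ne_zero.2 (Ne.symm hθ)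
            simpa [h5, h6] using h4.symm
          have hx : x = 0 := by
            rw [hy] at h1
            simpa [hr1] using h1
          simp [hx]
        · rw [if_pos h1, if_neg h2, if_pos (Or.inl h1), add_zero]
      · by_cases h2 : x * σ x = r2 y
        · rw [if_neg h1, if_pos h2, if_pos (Or.inr h2), zero_add]
        · rw [if_neg h1, if_neg h2, if_neg (by tauto), add_zero]
  · push Not at hy0
    rw [Finset.sum_eq_zero]
    · exact dvd_zero _
    intro y _
    refine Finset.sum_eq_zero fun x _ => ?_
    by_cases hx : x = 0
    · simp [hx]
    rw [if_neg]
    have hn0 : x * σ x ≠ 0 := fun h0 => hx (norm_eq_zero.1 h0)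
    by_cases hy : y = 0
    · subst hy
      simp [hx]
    have hδ := hy0 y hy
    set δ := d * y ^ 2 + H * (y * σ y) + σ d * σ y ^ 2 with hδdef
    have hδσ : σ δ = δ := by
      simp only [hδdef, map_add, map_mul, map_pow, h.involutive, hH]
      ring
    have hkσ : σ (x * σ x / δ) = x * σ x / δ := by rw [map_div₀, h.norm_fixed, hδσ]
    have hz : y * (θ - x * σ x / δ) ≠ 0 := by
      refine mul_ne_zero hy fun h0 => hθ ?_
      rw [sub_eq_zero.1 h0, hkσ]
    have h5 := mul_ne_zero hδ (hy0 _ hz)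
    intro h6
    apply h5
    rw [← h6]
    simp only [map_mul, map_sub, hkσ]
    generalize hn : x * σ x = n
    have : δ * (n / δ) = n := by field_simp
    generalize n / δ = k at this ⊢
    subst this
    simp only [hδdef]
    ring

end IsQuadConj
end QuadraticCharacterSums

section CountingSolutions

open scoped Classical

variable {F : Type*} [Field F]

/-- The sesquilinear form with Gram coefficients `N`. -/
def sesq (σ : F →+* F) (N : Fin 4 → F) (u w : F × F) : F :=
  N 0 * (σ u.1 * w.1) + N 1 * (σ u.1 * w.2) + N 2 * (σ u.2 * w.1) + N 3 * (σ u.2 * w.2)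

/-- The determinant of the matrix with rows `u`, `w`. -/
def pairDet (u w : F × F) : F := u.1 * w.2 - u.2 * w.1

/-- The resultant attached to `y` and the norm of `x`. -/
def pencilRes (σ : F →+* F) (N : Fin 4 → F) (θ x y : F) : F :=
  let d := N 0 * N 3 - N 1 * N 2
  let H := N 0 * σ (N 3) + σ (N 0) * N 3 - N 1 * σ (N 1) - N 2 * σ (N 2)
  (x * σ x) ^ 2 - x * σ x * (2 * d * θ * y ^ 2 + H * (θ + σ θ) * (y * σ y)
      + 2 * σ d * σ θ * σ y ^ 2)
    + (d * y ^ 2 + H * (y * σ y) + σ d * σ y ^ 2)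
      * (d * (y * θ) ^ 2 + H * (y * θ * σ (y * θ)) + σ d * σ (y * θ) ^ 2)

theorem sesq_smul (σ : F →+* F) (N : Fin 4 → F) (s : F) (u w : F × F) :
    sesq σ N (s • u) (s • w) = s * σ s * sesq σ N u w := by
  simp only [sesq, Prod.smul_fst, Prod.smul_snd, smul_eq_mul, map_mul]
  ring

namespace IsQuadConj

variable [Fintype F] {q : ℕ} {σ : F →+* F} (h : IsQuadConj q σ)
include h

theorem hermForm_eq_trace (N : Fin 4 → F) (y : F) (u : F × F) :
    hermForm σ (y * N 0 + σ (y * N 0)) (y * N 1 + σ (y * N 2)) (y * N 3 + σ (y * N 3)) u.1 u.2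
      = y * sesq σ N u u + σ (y * sesq σ N u u) := by
  simp only [hermForm, sesq, map_add, map_mul, h.involutive]
  ring

variable {e : AddChar F ℂ}

theorem sum_sum_eq_hermSum (N : Fin 4 → F) (θ x y : F) :
    ∑ u : F × F, ∑ w : F × F, e ((y * (θ * sesq σ N u u + sesq σ N w w)
        + σ (y * (θ * sesq σ N u u + sesq σ N w w)))
        + (x * pairDet u w + σ (x * pairDet u w)))
      = ∑ v : F, ∑ u : F, e (hermForm σ (y * θ * N 0 + σ (y * θ * N 0))
          (y * θ * N 1 + σ (y * θ * N 2)) (y * θ * N 3 + σ (y * θ * N 3)) u v)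
        * hermSum σ e (y * N 0 + σ (y * N 0)) (y * N 1 + σ (y * N 2)) (y * N 3 + σ (y * N 3))
          (-(x * v)) (x * u) := by
  rw [Fintype.sum_prod_type, Finset.sum_comm]
  refine Finset.sum_congr rfl fun v _ => Finset.sum_congr rfl fun u _ => ?_
  rw [Fintype.sum_prod_type, Finset.sum_comm, hermSum, Finset.mul_sum]
  refine Finset.sum_congr rfl fun v' _ => ?_
  rw [Finset.mul_sum]
  refine Finset.sum_congr rfl fun u' _ => ?_
  rw [← AddChar.map_add_eq_mul]
  congr 1
  have h1 := h.hermForm_eq_trace N (y * θ) (u, v)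
  have h2 := h.hermForm_eq_trace N y (u', v')
  simp only at h1 h2
  rw [h1, h2]
  simp only [pairDet, map_add, map_sub, map_neg, map_mul]
  ring

theorem exists_sum_sum_eq (he : e 1 ≠ 1) (N : Fin 4 → F) (θ : F) {x : F} (hx : x ≠ 0) (y : F) :
    ∃ z : ℤ, ∑ u : F × F, ∑ w : F × F, e ((y * (θ * sesq σ N u u + sesq σ N w w)
        + σ (y * (θ * sesq σ N u u + sesq σ N w w)))
        + (x * pairDet u w + σ (x * pairDet u w)))
      = q ^ 4 - (if pencilRes σ N θ x y = 0 then (q : ℂ) ^ 4 else 0) + q ^ 5 * z := by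
  rw [h.sum_sum_eq_hermSum]
  obtain ⟨h1, h2⟩ := h.sum_hermForm_hermSum he (h.trace_fixed (y * N 0)) (h.trace_fixed (y * N 3))
    (h.trace_fixed (y * θ * N 0)) (h.trace_fixed (y * θ * N 3)) hx
    (b := y * N 1 + σ (y * N 2)) (b' := y * θ * N 1 + σ (y * θ * N 2))
    (R := pencilRes σ N θ x y) (by
      simp only [pencilRes, map_add, map_sub, map_mul, h.involutive]
      ring)
  split_ifs with h0
  · obtain ⟨z, hz⟩ := h2 h0
    exact ⟨z, by rw [hz]; ring⟩
  · exact ⟨0, by rw [h1 h0]; push_cast; ring⟩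

theorem dvd_card_zeros (he : e 1 ≠ 1) (N : Fin 4 → F) (θ : F) :
    (q ^ 2 : ℤ) ∣ (Finset.univ.filter fun p : (F × F) × (F × F) =>
      θ * sesq σ N p.1 p.1 + sesq σ N p.2 p.2 = 0).card := by
  have hS : ∀ y : F, ∃ z : ℤ, ∑ u : F × F, e (y * sesq σ N u u + σ (y * sesq σ N u u))
      = q ^ 2 * z := by
    intro y
    have h1 : ∑ u : F × F, e (y * sesq σ N u u + σ (y * sesq σ N u u))
        = hermSum σ e (y * N 0 + σ (y * N 0)) (y * N 1 + σ (y * N 2)) (y * N 3 + σ (y * N 3))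
          0 0 := by
      rw [hermSum, Fintype.sum_prod_type, Finset.sum_comm]
      refine Finset.sum_congr rfl fun v _ => Finset.sum_congr rfl fun u _ => ?_
      rw [← h.hermForm_eq_trace]
      simp
    rw [h1]
    by_cases hδ : (y * N 0 + σ (y * N 0)) * (y * N 3 + σ (y * N 3))
        - (y * N 1 + σ (y * N 2)) * σ (y * N 1 + σ (y * N 2)) = 0
    · obtain ⟨z, hz⟩ := h.hermSum_zero_of_eq_zero he (h.trace_fixed _) (h.trace_fixed _) hδ
      exact ⟨q * z, by rw [hz]; push_cast; ring⟩
    · rw [h.hermSum_of_ne_zero he (h.trace_fixed _) (h.trace_fixed _) hδ]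
      exact ⟨1, by simp⟩
  choose z hz using hS
  have h2 : ((q : ℂ) ^ 2) * (Finset.univ.filter fun p : (F × F) × (F × F) =>
      θ * sesq σ N p.1 p.1 + sesq σ N p.2 p.2 = 0).card
      = ∑ y : F, ((q : ℂ) ^ 2 * (z (y * θ) : ℂ)) * (q ^ 2 * (z y : ℂ)) := by
    rw [Finset.card_filter]
    push_cast
    rw [Finset.mul_sum]
    have h3 : ∀ p : (F × F) × (F × F),
        (q : ℂ) ^ 2 * (if θ * sesq σ N p.1 p.1 + sesq σ N p.2 p.2 = 0 then 1 else 0)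
        = ∑ y : F, e (y * θ * sesq σ N p.1 p.1 + σ (y * θ * sesq σ N p.1 p.1))
          * e (y * sesq σ N p.2 p.2 + σ (y * sesq σ N p.2 p.2)) := by
      intro p
      rw [mul_ite, mul_one, mul_zero, ← h.sum_trace he]
      refine Finset.sum_congr rfl fun y _ => ?_
      rw [← AddChar.map_add_eq_mul]
      congr 1
      simp only [map_add, map_mul]
      ring
    simp_rw [h3]
    rw [Finset.sum_comm]
    refine Finset.sum_congr rfl fun y _ => ?_
    rw [← hz, ← hz, Fintype.sum_prod_type, Finset.sum_mul_sum]
  have hq0 : (q : ℂ) ≠ 0 := by have := h.three_le; exact_mod_cast (by omega : q ≠ 0)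
  refine ⟨∑ y : F, z (y * θ) * z y, ?_⟩
  have h4 : ((Finset.univ.filter fun p : (F × F) × (F × F) =>
      θ * sesq σ N p.1 p.1 + sesq σ N p.2 p.2 = 0).card : ℂ)
      = q ^ 2 * ∑ y : F, (z (y * θ) * z y : ℂ) := by
    apply mul_left_cancel₀ (pow_ne_zero 2 hq0)
    rw [h2, Finset.mul_sum, Finset.mul_sum]
    exact Finset.sum_congr rfl fun y _ => by ring
  exact_mod_cast h4

theorem sum_char_mul_trace (he : e 1 ≠ 1) : ∃ G : ℂ, ∃ s : ℤ, s ^ 2 = 1 ∧ G ^ 2 = s * q ^ 2 ∧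
    ∀ t : F, ∑ x : F, (quadraticChar F x : ℂ) * e (x * t + σ (x * t))
      = quadraticChar F t * G := by
  set ψ : AddChar F ℂ :=
    { toFun := fun z => e (z + σ z)
      map_zero_eq_one' := by simp
      map_add_eq_mul' := fun a b => by
        rw [← AddChar.map_add_eq_mul]
        congr 1
        rw [map_add]
        ring } with hψ
  have hψa : ∀ z, ψ z = e (z + σ z) := fun z => rfl
  have hprim : ψ.IsPrimitive := by
    apply AddChar.IsPrimitive.of_ne_one
    obtain ⟨t, ht⟩ := h.exists_trace_eq_one
    intro h1
    have h2 := hψa t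
    rw [h1, ht, AddChar.one_apply] at h2
    exact he h2.symm
  set χ : MulChar F ℂ := (quadraticChar F).ringHomComp (Int.castRingHom ℂ) with hχ
  have hχa : ∀ x, χ x = (quadraticChar F x : ℂ) := fun x => rfl
  have hχ1 : χ ≠ 1 := by
    obtain ⟨a, ha⟩ := quadraticChar_exists_neg_one' h.ringChar_ne_two
    intro h1
    have h2 := hχa a
    rw [h1, ha, MulChar.one_apply_coe] at h2
    norm_num at h2
  have hχq : χ.IsQuadratic := (quadraticChar_isQuadratic F).comp _
  refine ⟨gaussSum χ ψ, quadraticChar F (-1), ?_, ?_, ?_⟩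
  · rw [← map_pow]; simp
  · rw [gaussSum_sq hχ1 hχq hprim, h.card_eq, hχa]
    push_cast
    rfl
  · intro t
    by_cases ht : t = 0
    · subst ht
      simp only [mul_zero, map_zero, add_zero, AddChar.map_zero_eq_one, mul_one, MulChar.map_zero,
        Int.cast_zero, zero_mul]
      exact_mod_cast quadraticChar_sum_zero h.ringChar_ne_two
    · have h1 := gaussSum_mulShift χ ψ (Units.mk0 t ht)
      rw [Units.val_mk0] at h1
      have h2 : χ t * χ t = 1 := by
        rw [hχa]
        exact_mod_cast (by rw [← sq]; exact quadraticChar_sq_one ht)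
      rw [← h1, ← hχa, ← mul_assoc, h2, one_mul, gaussSum]
      refine Finset.sum_congr rfl fun x _ => ?_
      rw [AddChar.mulShift_apply, hψa, hχa, mul_comm x t]

theorem dvd_sum_char_pairDet (he : e 1 ≠ 1) (N : Fin 4 → F) {θ : F} (hθ : σ θ ≠ θ) :
    (q ^ 2 : ℤ) ∣ ∑ u : F × F, ∑ w : F × F,
      if θ * sesq σ N u u + sesq σ N w w = 0 then quadraticChar F (pairDet u w) else 0 := by
  set D := ∑ u : F × F, ∑ w : F × F,
      if θ * sesq σ N u u + sesq σ N w w = 0 then quadraticChar F (pairDet u w) else 0 with hD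
  obtain ⟨G, s, hs, hG, hsum⟩ := h.sum_char_mul_trace he
  have h1 : ∀ x y : F, ∃ z : ℤ, x ≠ 0 → ∑ u : F × F, ∑ w : F × F,
      e ((y * (θ * sesq σ N u u + sesq σ N w w) + σ (y * (θ * sesq σ N u u + sesq σ N w w)))
        + (x * pairDet u w + σ (x * pairDet u w)))
      = q ^ 4 - (if pencilRes σ N θ x y = 0 then (q : ℂ) ^ 4 else 0) + q ^ 5 * z := by
    intro x y
    by_cases hx : x = 0
    · exact ⟨0, fun h0 => absurd hx h0⟩
    · obtain ⟨z, hz⟩ := h.exists_sum_sum_eq he N θ hx y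
      exact ⟨z, fun _ => hz⟩
  choose z hz using h1
  have h2 : (q : ℂ) ^ 2 * D * G = ∑ y : F, ∑ x : F, (quadraticChar F x : ℂ) *
      ∑ u : F × F, ∑ w : F × F,
      e ((y * (θ * sesq σ N u u + sesq σ N w w) + σ (y * (θ * sesq σ N u u + sesq σ N w w)))
        + (x * pairDet u w + σ (x * pairDet u w))) := by
    have h3 : ∀ u w : F × F, (q : ℂ) ^ 2 * ((if θ * sesq σ N u u + sesq σ N w w = 0
          then quadraticChar F (pairDet u w) else 0 : ℤ) : ℂ) * G
        = ∑ y : F, ∑ x : F, (quadraticChar F x : ℂ) *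
        e ((y * (θ * sesq σ N u u + sesq σ N w w) + σ (y * (θ * sesq σ N u u + sesq σ N w w)))
        + (x * pairDet u w + σ (x * pairDet u w))) := by
      intro u w
      have h4 : ∀ y : F, ∑ x : F, (quadraticChar F x : ℂ) *
          e ((y * (θ * sesq σ N u u + sesq σ N w w) + σ (y * (θ * sesq σ N u u + sesq σ N w w)))
          + (x * pairDet u w + σ (x * pairDet u w)))
          = e ((θ * sesq σ N u u + sesq σ N w w) * y + σ ((θ * sesq σ N u u + sesq σ N w w) * y))
            * (quadraticChar F (pairDet u w) * G) := by
        intro y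
        rw [← hsum, Finset.mul_sum]
        refine Finset.sum_congr rfl fun x _ => ?_
        rw [mul_comm y, AddChar.map_add_eq_mul]
        ring
      simp_rw [h4]
      rw [← Finset.sum_mul, h.sum_trace he]
      split_ifs
      · ring
      · simp
    rw [hD]
    push_cast only [Int.cast_sum]
    simp_rw [Finset.mul_sum, Finset.sum_mul, h3]
    rw [Finset.sum_congr rfl fun u _ => Finset.sum_comm, Finset.sum_comm]
    refine Finset.sum_congr rfl fun y _ => ?_
    rw [Finset.sum_congr rfl fun u _ => Finset.sum_comm, Finset.sum_comm]
  obtain ⟨E, hE⟩ := h.dvd_sum_resultant (θ := θ) (d := N 0 * N 3 - N 1 * N 2)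
    (H := N 0 * σ (N 3) + σ (N 0) * N 3 - N 1 * σ (N 1) - N 2 * σ (N 2)) hθ
    (by simp only [map_add, map_sub, map_mul, h.involutive]; ring)
  replace hE : ∑ y : F, ∑ x : F, (if pencilRes σ N θ x y = 0 then quadraticChar F x else 0)
      = q * E := hE
  set W : ℤ := -E + ∑ y : F, ∑ x : F, quadraticChar F x * z x y with hW
  have h5 : (q : ℂ) ^ 2 * D * G = q ^ 5 * W := by
    rw [h2]
    have h6 : ∀ x y : F, (quadraticChar F x : ℂ) * ∑ u : F × F, ∑ w : F × F,
        e ((y * (θ * sesq σ N u u + sesq σ N w w) + σ (y * (θ * sesq σ N u u + sesq σ N w w)))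
          + (x * pairDet u w + σ (x * pairDet u w)))
        = ((q ^ 4 * quadraticChar F x
          - q ^ 4 * (if pencilRes σ N θ x y = 0 then quadraticChar F x else 0)
          + q ^ 5 * (quadraticChar F x * z x y) : ℤ) : ℂ) := by
      intro x y
      by_cases hx : x = 0
      · subst hx; simp
      · rw [hz x y hx]
        push_cast
        split_ifs <;> ring
    simp_rw [h6]
    have h7 : ∑ y : F, ∑ x : F, (q ^ 4 * quadraticChar F x
          - q ^ 4 * (if pencilRes σ N θ x y = 0 then quadraticChar F x else 0)
          + q ^ 5 * (quadraticChar F x * z x y) : ℤ) = q ^ 5 * W := by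
      simp_rw [Finset.sum_add_distrib, Finset.sum_sub_distrib, ← Finset.mul_sum]
      rw [hE, quadraticChar_sum_zero h.ringChar_ne_two, hW]
      simp
      ring
    exact_mod_cast h7
  have hq0 : (q : ℂ) ≠ 0 := by have := h.three_le; exact_mod_cast (by omega : q ≠ 0)
  have h8 : (D : ℂ) ^ 2 * s = q ^ 4 * W ^ 2 := by
    apply mul_left_cancel₀ (pow_ne_zero 6 hq0)
    have h9 : ((q : ℂ) ^ 2 * D * G) ^ 2 = (q ^ 5 * W) ^ 2 := by rw [h5]
    rw [mul_pow, hG] at h9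
    linear_combination h9
  have h10 : D ^ 2 * s = q ^ 4 * W ^ 2 := by exact_mod_cast h8
  have h11 : ((q : ℤ) ^ 2) ^ 2 ∣ D ^ 2 := by
    refine ⟨W ^ 2 * s, ?_⟩
    linear_combination s * h10 - D ^ 2 * hs
  exact (Int.pow_dvd_pow_iff (by norm_num)).1 h11

end IsQuadConj
end CountingSolutions

section CountingUnimodularPairs

open scoped Classical

variable {F : Type*} [Field F]

theorem exists_pairDet_eq {u : F × F} (hu : u ≠ 0) (c : F) : ∃ w, pairDet u w = c := by
  by_cases h1 : u.1 = 0
  · have h2 : u.2 ≠ 0 := fun h2 => hu (Prod.ext h1 h2)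
    exact ⟨(-c / u.2, 0), by simp only [pairDet]; field_simp; simp⟩
  · exact ⟨(0, c / u.1), by simp only [pairDet]; field_simp; simp⟩

theorem exists_smul_of_pairDet_eq_zero {u w : F × F} (hu : u ≠ 0) (h : pairDet u w = 0) :
    ∃ t : F, w = t • u := by
  simp only [pairDet] at h
  by_cases h1 : u.1 = 0
  · have h2 : u.2 ≠ 0 := fun h2 => hu (Prod.ext h1 h2)
    refine ⟨w.2 / u.2, Prod.ext ?_ ?_⟩
    · rw [h1] at h
      simp only [Prod.smul_fst, smul_eq_mul, h1]
      simpa [h2] using h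
    · simp only [Prod.smul_snd, smul_eq_mul]
      field_simp
  · refine ⟨w.1 / u.1, Prod.ext ?_ ?_⟩
    · simp only [Prod.smul_fst, smul_eq_mul]
      field_simp
    · simp only [Prod.smul_snd, smul_eq_mul]
      field_simp
      linear_combination h

variable [Fintype F]

theorem card_pairDet_eq {u w₀ : F × F} (hu : u ≠ 0) (P : F × F → Prop) [DecidablePred P] :
    (Finset.univ.filter fun w => pairDet u w = pairDet u w₀ ∧ P w).card
      = (Finset.univ.filter fun t : F => P (w₀ + t • u)).card := by
  symm
  refine Finset.card_bij (fun t _ => w₀ + t • u) ?_ ?_ ?_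
  · intro t ht
    simp only [Finset.mem_filter, Finset.mem_univ, true_and] at ht ⊢
    refine ⟨?_, ht⟩
    simp only [pairDet, Prod.fst_add, Prod.snd_add, Prod.smul_fst, Prod.smul_snd, smul_eq_mul]
    ring
  · intro t _ t' _ ht
    exact smul_left_injective F hu (add_left_cancel ht)
  · intro w hw
    simp only [Finset.mem_filter, Finset.mem_univ, true_and] at hw
    obtain ⟨t, ht⟩ := exists_smul_of_pairDet_eq_zero (w := w - w₀) hu (by
      have := hw.1
      simp only [pairDet, Prod.fst_sub, Prod.snd_sub] at this ⊢
      linear_combination this)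
    have hw' : w = w₀ + t • u := by rw [← ht]; abel
    refine ⟨t, ?_, hw'.symm⟩
    simpa [← hw'] using hw.2

namespace IsQuadConj

variable {q : ℕ} {σ : F →+* F} (h : IsQuadConj q σ)
include h

theorem card_prod : Fintype.card (F × F) = q ^ 4 := by
  rw [Fintype.card_prod, h.card_eq]; ring

theorem card_prod_ne_zero : ((Finset.univ.filter fun u : F × F => u ≠ 0).card : ℤ) = q ^ 4 - 1 := by
  have h1 := Finset.card_filter_add_card_filter_not (s := (Finset.univ : Finset (F × F)))
    (fun u => u = 0)
  rw [Finset.filter_eq' Finset.univ (0 : F × F), Finset.card_univ, h.card_prod] at h1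
  simp only [Finset.mem_univ, if_true, Finset.card_singleton] at h1
  have h2 : (1 + (Finset.univ.filter fun u : F × F => u ≠ 0).card : ℤ) = q ^ 4 := by
    exact_mod_cast h1
  linarith

/-- The number of pairs of determinant one. -/
theorem card_pairDet_eq_one :
    ((Finset.univ.filter fun p : (F × F) × (F × F) => pairDet p.1 p.2 = 1).card : ℤ)
      = q ^ 2 * (q ^ 4 - 1) := by
  rw [Finset.card_filter, Fintype.sum_prod_type]
  simp_rw [← Finset.card_filter]
  have h1 : ∀ u : F × F, (Finset.univ.filter fun w => pairDet u w = 1).card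
      = if u ≠ 0 then q ^ 2 else 0 := by
    intro u
    split_ifs with hu
    · obtain ⟨w₀, hw₀⟩ := exists_pairDet_eq hu (1 : F)
      have := card_pairDet_eq hu (w₀ := w₀) fun _ => True
      simpa [hw₀, h.card_eq] using this
    · push Not at hu
      simp [hu, pairDet]
  simp_rw [h1]
  rw [← Finset.sum_filter, Finset.sum_const]
  rw [nsmul_eq_mul]
  push_cast
  rw [h.card_prod_ne_zero]
  ring

theorem exists_unique_mul_add_conj {ζ : F} (hζ : ζ * σ ζ = -1) (c : F) :
    ∃! t : F, ζ * t + σ t = c := by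
  let f : F →+ F := (AddMonoidHom.mulLeft ζ) + (σ : F →+ F)
  have hf : ∀ t, f t = ζ * t + σ t := fun t => rfl
  have hinj : Function.Injective f := by
    rw [injective_iff_map_eq_zero]
    intro t ht
    rw [hf] at ht
    have h1 := congrArg σ ht
    simp only [map_add, map_mul, h.involutive, map_zero] at h1
    have h2 : 2 * t = 0 := by linear_combination h1 - σ ζ * ht + t * hζ
    exact (mul_eq_zero.1 h2).resolve_left h.two_ne_zero
  obtain ⟨t, ht⟩ := (Finite.injective_iff_surjective.1 hinj) c
  exact ⟨t, ht, fun t' ht' => hinj (ht'.trans ht.symm)⟩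

theorem dvd_card_skew_zeros {ζ : F} (hζ : ζ * σ ζ = -1) (N : Fin 4 → F) :
    (q ^ 2 : ℤ) ∣ (Finset.univ.filter fun p : (F × F) × (F × F) => pairDet p.1 p.2 = 1 ∧
      ζ * sesq σ N p.1 p.2 + sesq σ N p.2 p.1 = 0).card + 1
      + (Finset.univ.filter fun u : F × F => u ≠ 0 ∧ sesq σ N u u = 0).card := by
  rw [Finset.card_filter, Fintype.sum_prod_type]
  simp_rw [← Finset.card_filter]
  have h1 : ∀ u : F × F, ∃ z : ℤ, ((Finset.univ.filter fun w => pairDet u w = 1 ∧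
      ζ * sesq σ N u w + sesq σ N w u = 0).card : ℤ)
      = (if u ≠ 0 then 1 else 0) - (if u ≠ 0 ∧ sesq σ N u u = 0 then 1 else 0) + q ^ 2 * z := by
    intro u
    by_cases hu : u = 0
    · exact ⟨0, by simp [hu, pairDet]⟩
    · obtain ⟨w₀, hw₀⟩ := exists_pairDet_eq hu (1 : F)
      have h2 := card_pairDet_eq hu (w₀ := w₀) fun w => ζ * sesq σ N u w + sesq σ N w u = 0
      rw [hw₀] at h2
      have h3 : ∀ t : F, ζ * sesq σ N u (w₀ + t • u) + sesq σ N (w₀ + t • u) u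
          = ζ * sesq σ N u w₀ + sesq σ N w₀ u + (ζ * t + σ t) * sesq σ N u u := by
        intro t
        simp only [sesq, Prod.fst_add, Prod.snd_add, Prod.smul_fst, Prod.smul_snd, smul_eq_mul,
          map_add, map_mul]
        ring
      simp only [h3] at h2
      rw [h2]
      by_cases hg : sesq σ N u u = 0
      · simp only [hg, hu, mul_zero, add_zero, ne_eq, not_false_eq_true, and_self, if_true,
          sub_self, zero_add]
        by_cases hc : ζ * sesq σ N u w₀ + sesq σ N w₀ u = 0
        · exact ⟨1, by simp [hc, h.card_eq]⟩
        · exact ⟨0, by simp [hc]⟩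
      · refine ⟨0, ?_⟩
        obtain ⟨t, ht, huniq⟩ := h.exists_unique_mul_add_conj hζ
          (-(ζ * sesq σ N u w₀ + sesq σ N w₀ u) / sesq σ N u u)
        have h4 : (Finset.univ.filter fun t : F => ζ * sesq σ N u w₀ + sesq σ N w₀ u
            + (ζ * t + σ t) * sesq σ N u u = 0) = {t} := by
          ext t'
          simp only [Finset.mem_filter, Finset.mem_univ, true_and, Finset.mem_singleton]
          constructor
          · intro h5
            apply huniq
            field_simp
            linear_combination h5
          · rintro rfl
            rw [ht]
            field_simp
            ring
        rw [h4]
        simp [hu, hg]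
  choose z hz using h1
  push_cast
  simp_rw [hz]
  rw [Finset.sum_add_distrib, Finset.sum_sub_distrib, ← Finset.mul_sum, Finset.sum_boole,
    Finset.sum_boole, h.card_prod_ne_zero]
  exact ⟨q ^ 2 + ∑ u, z u, by ring⟩

theorem card_singular_zeros {θ : F} (hθ : σ θ ≠ θ) (N : Fin 4 → F) :
    ((Finset.univ.filter fun p : (F × F) × (F × F) => pairDet p.1 p.2 = 0 ∧
      θ * sesq σ N p.1 p.1 + sesq σ N p.2 p.2 = 0).card : ℤ) = 1 + (q ^ 2 + 1) *
      (Finset.univ.filter fun u : F × F => u ≠ 0 ∧ sesq σ N u u = 0).card := by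
  rw [Finset.card_filter, Fintype.sum_prod_type]
  simp_rw [← Finset.card_filter]
  set a := (Finset.univ.filter fun u : F × F => u ≠ 0 ∧ sesq σ N u u = 0).card with ha
  have h1 : ∀ u : F × F, (Finset.univ.filter fun w => pairDet u w = 0 ∧
      θ * sesq σ N u u + sesq σ N w w = 0).card
      = (if u = 0 then 1 + a else 0) + q ^ 2 * (if u ≠ 0 ∧ sesq σ N u u = 0 then 1 else 0) := by
    intro u
    by_cases hu : u = 0
    · subst hu
      have h2 : (Finset.univ.filter fun w => pairDet (0 : F × F) w = 0 ∧
          θ * sesq σ N 0 0 + sesq σ N w w = 0)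
          = insert 0 (Finset.univ.filter fun u : F × F => u ≠ 0 ∧ sesq σ N u u = 0) := by
        ext w
        rw [Finset.mem_insert, Finset.mem_filter, Finset.mem_filter]
        by_cases hw : w = 0 <;> simp [hw, pairDet, sesq]
      rw [h2, Finset.card_insert_of_notMem (by simp), ← ha]
      simp
      ring
    · have h2 := card_pairDet_eq hu (w₀ := 0) fun w => θ * sesq σ N u u + sesq σ N w w = 0
      have h3 : pairDet u 0 = 0 := by simp [pairDet]
      rw [h3] at h2
      rw [h2]
      have h4 : ∀ t : F, θ * sesq σ N u u + sesq σ N (0 + t • u) (0 + t • u)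
          = (θ + t * σ t) * sesq σ N u u := by
        intro t
        rw [zero_add, sesq_smul]
        ring
      have h5 : ∀ t : F, θ + t * σ t ≠ 0 := by
        intro t h6
        apply hθ
        rw [eq_neg_of_add_eq_zero_left h6, map_neg, h.norm_fixed]
      simp only [h4]
      simp only [mul_eq_zero, h5, false_or, hu, if_false, ne_eq, not_false_eq_true, true_and,
        zero_add]
      by_cases hg : sesq σ N u u = 0
      · simp [hg, h.card_eq]
      · simp [hg]
  simp_rw [h1]
  rw [Finset.sum_add_distrib, ← Finset.mul_sum, Finset.sum_ite_eq' Finset.univ (0 : F × F),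
    if_pos (Finset.mem_univ _), ← Finset.card_filter, ← ha]
  push_cast
  ring

omit h in
theorem card_twisted_zeros {s : F} (hs : s ≠ 0) (θ : F) (N : Fin 4 → F) :
    (Finset.univ.filter fun p : (F × F) × (F × F) =>
      θ * sesq σ N p.1 p.1 + sesq σ N p.2 p.2 = 0 ∧ s ^ 2 = pairDet p.1 p.2).card
    = (Finset.univ.filter fun p : (F × F) × (F × F) => pairDet p.1 p.2 = 1 ∧
      θ * sesq σ N p.1 p.1 + sesq σ N p.2 p.2 = 0).card := by
  have hdet : ∀ (t : F) (u w : F × F), pairDet (t • u) (t • w) = t ^ 2 * pairDet u w := by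
    intro t u w
    simp only [pairDet, Prod.smul_fst, Prod.smul_snd, smul_eq_mul]
    ring
  refine Finset.card_bij' (fun p _ => s⁻¹ • p) (fun p _ => s • p) ?_ ?_ ?_ ?_
  · intro p hp
    simp only [Finset.mem_filter, Finset.mem_univ, true_and, Prod.smul_fst, Prod.smul_snd,
      hdet, sesq_smul] at hp ⊢
    refine ⟨?_, ?_⟩
    · rw [← hp.2]; field_simp
    · linear_combination s⁻¹ * σ s⁻¹ * hp.1
  · intro p hp
    simp only [Finset.mem_filter, Finset.mem_univ, true_and, Prod.smul_fst, Prod.smul_snd,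
      hdet, sesq_smul] at hp ⊢
    refine ⟨?_, ?_⟩
    · linear_combination s * σ s * hp.2
    · rw [hp.1, mul_one]
  · intro p _; exact smul_inv_smul₀ hs p
  · intro p _; exact inv_smul_smul₀ hs p

theorem dvd_card_twisted_zeros {θ : F} (hθ : σ θ ≠ θ) (N : Fin 4 → F) :
    (q ^ 2 : ℤ) ∣ (Finset.univ.filter fun p : (F × F) × (F × F) => pairDet p.1 p.2 = 1 ∧
      θ * sesq σ N p.1 p.1 + sesq σ N p.2 p.2 = 0).card - 1
      - (Finset.univ.filter fun u : F × F => u ≠ 0 ∧ sesq σ N u u = 0).card := by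
  obtain ⟨e, he⟩ := AddChar.exists_apply_ne_zero.2 (one_ne_zero (α := F))
  obtain ⟨Z, hZ⟩ := h.dvd_card_zeros he N θ
  obtain ⟨D, hD⟩ := h.dvd_sum_char_pairDet he N hθ
  have h0 := h.card_singular_zeros hθ N
  set a := (Finset.univ.filter fun u : F × F => u ≠ 0 ∧ sesq σ N u u = 0).card with ha
  set n := (Finset.univ.filter fun p : (F × F) × (F × F) => pairDet p.1 p.2 = 1 ∧
      θ * sesq σ N p.1 p.1 + sesq σ N p.2 p.2 = 0).card with hn
  have h1 : ∑ s : F, ((Finset.univ.filter fun p : (F × F) × (F × F) =>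
      θ * sesq σ N p.1 p.1 + sesq σ N p.2 p.2 = 0 ∧ s ^ 2 = pairDet p.1 p.2).card : ℤ)
      = q ^ 2 * Z + q ^ 2 * D := by
    rw [← hZ, ← hD, ← Fintype.sum_prod_type']
    simp_rw [Finset.card_filter]
    push_cast
    rw [Finset.sum_comm, ← Finset.sum_add_distrib]
    refine Finset.sum_congr rfl fun p _ => ?_
    by_cases hp : θ * sesq σ N p.1 p.1 + sesq σ N p.2 p.2 = 0
    · simp only [hp, true_and, if_true]
      have h2 := quadraticChar_card_sqrts h.ringChar_ne_two (pairDet p.1 p.2)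
      rw [Finset.sum_boole, add_comm 1, ← h2]
      congr 2
      ext s
      simp
    · simp [hp]
  rw [← Finset.add_sum_erase _ _ (Finset.mem_univ (0 : F)),
    Finset.sum_congr rfl (g := fun _ => (n : ℤ)) fun s hs => by
      rw [card_twisted_zeros (Finset.ne_of_mem_erase hs)],
    Finset.sum_const, Finset.card_erase_of_mem (Finset.mem_univ _), Finset.card_univ,
    nsmul_eq_mul, Nat.cast_sub Fintype.card_pos, h.card_eq] at h1
  have h3 : (Finset.univ.filter fun p : (F × F) × (F × F) =>
      θ * sesq σ N p.1 p.1 + sesq σ N p.2 p.2 = 0 ∧ (0 : F) ^ 2 = pairDet p.1 p.2)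
      = Finset.univ.filter fun p : (F × F) × (F × F) => pairDet p.1 p.2 = 0 ∧
      θ * sesq σ N p.1 p.1 + sesq σ N p.2 p.2 = 0 := by
    ext p
    simp [and_comm, eq_comm]
  rw [h3, h0] at h1
  push_cast at h1
  refine ⟨n + a - Z - D, ?_⟩
  linear_combination -h1

end IsQuadConj
end CountingUnimodularPairs

section Decomposition

variable {F : Type*} [Field F]

/-- The vector `uᑫ ⊗ w`. -/
def hvec (σ : F →+* F) (u w : F × F) : Fin 4 → F :=
  ![σ u.1 * w.1, σ u.1 * w.2, σ u.2 * w.1, σ u.2 * w.2]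

/-- The quadratic form `X₁X₄ - X₂X₃`. -/
def det4 (v : Fin 4 → F) : F := v 0 * v 3 - v 1 * v 2

/-- The Hermitian form on `F⁴`. -/
def herm4 (σ : F →+* F) (v : Fin 4 → F) : F :=
  σ (v 0) * v 3 + v 0 * σ (v 3) - v 1 * σ (v 1) - v 2 * σ (v 2)

/-- The conjugate transpose, in coordinates. -/
def star4 (σ : F →+* F) (v : Fin 4 → F) : Fin 4 → F := ![σ (v 0), σ (v 2), σ (v 1), σ (v 3)]

omit [Field F] in
theorem funext_fin_four {v w : Fin 4 → F} (h0 : v 0 = w 0) (h1 : v 1 = w 1) (h2 : v 2 = w 2)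
    (h3 : v 3 = w 3) : v = w := by
  funext i
  fin_cases i <;> assumption

variable (σ : F →+* F)

theorem hvec_smul (s t : F) (u w : F × F) :
    hvec σ (s • u) (t • w) = (σ s * t) • hvec σ u w := by
  apply funext_fin_four <;> simp [hvec] <;> ring

theorem star4_add (v w : Fin 4 → F) : star4 σ (v + w) = star4 σ v + star4 σ w := by
  apply funext_fin_four <;> simp [star4]

theorem star4_smul (c : F) (v : Fin 4 → F) : star4 σ (c • v) = σ c • star4 σ v := by
  apply funext_fin_four <;> simp [star4]

theorem det4_smul (c : F) (v : Fin 4 → F) : det4 (c • v) = c ^ 2 * det4 v := by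
  simp only [det4, Pi.smul_apply, smul_eq_mul]; ring

theorem herm4_smul (c : F) (v : Fin 4 → F) : herm4 σ (c • v) = c * σ c * herm4 σ v := by
  simp only [herm4, Pi.smul_apply, smul_eq_mul, map_mul]; ring

theorem ne_zero_of_det4_ne_zero {v : Fin 4 → F} (h : det4 v ≠ 0) : v ≠ 0 := by
  rintro rfl
  simp [det4] at h

theorem dotProduct_hvec (N : Fin 4 → F) (u w : F × F) : N ⬝ᵥ hvec σ u w = sesq σ N u w := by
  simp [dotProduct, Fin.sum_univ_four, hvec, sesq]

theorem hvec_eq_zero_iff {u w : F × F} : hvec σ u w = 0 ↔ u = 0 ∨ w = 0 := by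
  constructor
  · intro h
    by_contra! hne
    have h0 := congrFun h 0
    have h1 := congrFun h 1
    have h2 := congrFun h 2
    have h3 := congrFun h 3
    simp only [hvec, Matrix.cons_val, Pi.zero_apply, mul_eq_zero, map_eq_zero] at h0 h1 h2 h3
    obtain ⟨hu, hw⟩ := hne
    rw [Ne, Prod.ext_iff] at hu hw
    simp only [Prod.fst_zero, Prod.snd_zero] at hu hw
    tauto
  · rintro (rfl | rfl) <;> apply funext_fin_four <;> simp [hvec]

theorem exists_smul_right_of_hvec_eq {u w u' w' : F × F} {c : F} (hu : u' ≠ 0)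
    (h : hvec σ u' w' = c • hvec σ u w) : ∃ κ : F, w' = κ • w := by
  have h0 := congrFun h 0
  have h1 := congrFun h 1
  have h2 := congrFun h 2
  have h3 := congrFun h 3
  simp only [hvec, Matrix.cons_val, Pi.smul_apply, smul_eq_mul] at h0 h1 h2 h3
  by_cases h4 : u'.1 = 0
  · have h5 : u'.2 ≠ 0 := fun h5 => hu (Prod.ext h4 h5)
    have h6 : σ u'.2 ≠ 0 := by simpa using h5
    refine ⟨c * σ u.2 / σ u'.2, Prod.ext ?_ ?_⟩
    · simp only [Prod.smul_fst, smul_eq_mul]; field_simp; linear_combination h2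
    · simp only [Prod.smul_snd, smul_eq_mul]; field_simp; linear_combination h3
  · have h6 : σ u'.1 ≠ 0 := by simpa using h4
    refine ⟨c * σ u.1 / σ u'.1, Prod.ext ?_ ?_⟩
    · simp only [Prod.smul_fst, smul_eq_mul]; field_simp; linear_combination h0
    · simp only [Prod.smul_snd, smul_eq_mul]; field_simp; linear_combination h1

theorem det4_diag (a b : F) (u w : F × F) :
    det4 (a • hvec σ u u + b • hvec σ w w) = a * b * (pairDet u w * σ (pairDet u w)) := by
  simp only [det4, hvec, pairDet, Pi.add_apply, Pi.smul_apply, smul_eq_mul, Matrix.cons_val,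
    map_sub, map_mul]
  ring

theorem det4_skew (ζ : F) (u w : F × F) :
    det4 (ζ • hvec σ u w + hvec σ w u) = -ζ * (pairDet u w * σ (pairDet u w)) := by
  simp only [det4, hvec, pairDet, Pi.add_apply, Pi.smul_apply, smul_eq_mul, Matrix.cons_val,
    map_sub, map_mul]
  ring

namespace IsQuadConj

variable {σ}
variable [Fintype F] {q : ℕ} (h : IsQuadConj q σ)
include h

theorem star4_hvec (u w : F × F) : star4 σ (hvec σ u w) = hvec σ w u := by
  apply funext_fin_four <;> simp [star4, hvec, h.involutive, mul_comm]

theorem herm4_diag (a b : F) (u w : F × F) : herm4 σ (a • hvec σ u u + b • hvec σ w w)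
    = (a * σ b + σ a * b) * (pairDet u w * σ (pairDet u w)) := by
  simp only [herm4, hvec, pairDet, Pi.add_apply, Pi.smul_apply, smul_eq_mul, Matrix.cons_val,
    map_sub, map_mul, map_add, h.involutive]
  ring

theorem herm4_hvec (u w : F × F) : herm4 σ (hvec σ u w) = -(pairDet u w * σ (pairDet u w)) := by
  simp only [herm4, hvec, pairDet, Matrix.cons_val, map_sub, map_mul, h.involutive]
  ring

theorem herm4_skew {ζ : F} (hζ : ζ * σ ζ = -1) (u w : F × F) :
    herm4 σ (ζ • hvec σ u w + hvec σ w u) = 0 := by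
  simp only [herm4, hvec, Pi.add_apply, Pi.smul_apply, smul_eq_mul, Matrix.cons_val,
    map_mul, map_add, h.involutive]
  linear_combination (-((u.1 * w.2 - u.2 * w.1) * (σ u.1 * σ w.2 - σ u.2 * σ w.1))) * hζ

theorem exists_eq_smul_hvec {v : Fin 4 → F} (hd : det4 v = 0) (hH : herm4 σ v = 0) :
    ∃ (c : F) (u : F × F), v = c • hvec σ u u := by
  obtain ⟨a, b, hab⟩ : ∃ a b, v = hvec σ a b := by
    by_cases hb : ((v 0, v 1) : F × F) = 0
    · rw [Prod.mk_eq_zero] at hb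
      exact ⟨(0, 1), (v 2, v 3), by apply funext_fin_four <;> simp [hvec, hb]⟩
    · obtain ⟨t, ht⟩ := exists_smul_of_pairDet_eq_zero (w := (v 2, v 3)) hb hd
      rw [Prod.ext_iff] at ht
      simp only [Prod.smul_fst, Prod.smul_snd, smul_eq_mul] at ht
      exact ⟨(1, σ t), (v 0, v 1), by
        apply funext_fin_four <;> simp [hvec, ht, h.involutive]⟩
  by_cases ha : a = 0
  · refine ⟨0, 0, ?_⟩
    rw [hab, ha, zero_smul, hvec_eq_zero_iff]
    exact Or.inl rfl
  · rw [hab, h.herm4_hvec, neg_eq_zero, norm_eq_zero] at hH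
    obtain ⟨t, rfl⟩ := exists_smul_of_pairDet_eq_zero ha hH
    refine ⟨t, a, ?_⟩
    have := hvec_smul σ 1 t a a
    rwa [one_smul, map_one, one_mul, ← hab] at this

/-- Eigenvectors of the pencil spanned by a matrix and its conjugate transpose. -/
theorem exists_star4_sub_eq {v : Fin 4 → F} {l : F}
    (hl : l ^ 2 * det4 v - l * herm4 σ v + σ (det4 v) = 0)
    (hN : (l * σ l) ^ 2 = 1) (hH : herm4 σ v ≠ 0) :
    ∃ (c : F) (u : F × F), star4 σ v - l • v = c • hvec σ u u := by
  have hσ : σ (herm4 σ v) = herm4 σ v := by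
    simp only [herm4, map_add, map_sub, map_mul, h.involutive]; ring
  apply h.exists_eq_smul_hvec
  · rw [← hl]
    simp only [det4, herm4, star4, Pi.sub_apply, Pi.smul_apply, smul_eq_mul, Matrix.cons_val,
      map_sub, map_mul]
    ring
  · have h1 : herm4 σ (star4 σ v - l • v)
        = herm4 σ v * (1 + l * σ l) - 2 * σ l * σ (det4 v) - 2 * l * det4 v := by
      simp only [det4, herm4, star4, Pi.sub_apply, Pi.smul_apply, smul_eq_mul, Matrix.cons_val,
        map_sub, map_mul, h.involutive]
      ring
    rw [h1]
    have hl' := congrArg σ hl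
    simp only [map_add, map_sub, map_mul, map_pow, h.involutive, map_zero, hσ] at hl'
    rcases sq_eq_one_iff.1 hN with h2 | h2
    · linear_combination (-2 * σ l) * hl + (2 * l * det4 v - herm4 σ v) * h2
    · refine absurd (mul_left_cancel₀ h.two_ne_zero ?_) hH
      linear_combination σ l * hl + l * hl'
        - (l * det4 v + σ l * σ (det4 v) - 2 * herm4 σ v) * h2

end IsQuadConj
end Decomposition

section Cgam

variable {F : Type*} [Field F] [Fintype F]

omit [Fintype F] in
theorem pairDet_smul (s t : F) (u w : F × F) :
    pairDet (s • u) (t • w) = s * t * pairDet u w := by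
  simp only [pairDet, Prod.smul_fst, Prod.smul_snd, smul_eq_mul]; ring

namespace IsQuadConj

variable {σ : F →+* F} {q r : ℕ} (h : IsQuadConj q σ)
include h

theorem fgam_eq (γ : F) (v : Fin 4 → F) :
    Fgam q γ v = herm4 σ v - γ * det4 v ^ ((q + 1) / 2) := by
  simp only [Fgam, herm4, det4, h.apply_eq]; ring

theorem apply_eq_mul_self (hr : q = 2 * r + 1) (x : F) : σ x = (x ^ r) ^ 2 * x := by
  rw [h.apply_eq, hr]; ring

theorem pow_ne_zero_sq_norm (hr : q = 2 * r + 1) {x : F} (hx : x ≠ 0) :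
    (x ^ r * σ (x ^ r)) ^ 2 = 1 := by
  rw [← h.norm_eq, ← pow_mul, ← pow_mul, ← FiniteField.pow_card_sub_one_eq_one x hx,
    h.card_sub_one, hr]
  congr 1
  simp
  ring

/-- The scalar `ξ ^ (j (q - 1) / 2) + ξ ^ (-j (q - 1) / 2)` is nonzero. -/
theorem add_inv_ne_zero (hr : q = 2 * r + 1) {θ : F} (hθ0 : θ ≠ 0) (hθ' : σ θ ≠ -θ) :
    θ ^ r + (θ ^ r)⁻¹ ≠ 0 := by
  intro h0
  apply hθ'
  have hε : θ ^ r ≠ 0 := pow_ne_zero _ hθ0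
  rw [h.apply_eq_mul_self hr]
  field_simp at h0
  linear_combination θ * h0

theorem exists_eq_diag {v : Fin 4 → F} {l m : F} (hlm : l ≠ m)
    (hl : l ^ 2 * det4 v - l * herm4 σ v + σ (det4 v) = 0) (hNl : (l * σ l) ^ 2 = 1)
    (hm : m ^ 2 * det4 v - m * herm4 σ v + σ (det4 v) = 0) (hNm : (m * σ m) ^ 2 = 1)
    (hH : herm4 σ v ≠ 0) :
    ∃ (a b : F) (u w : F × F), v = a • hvec σ u u + b • hvec σ w w := by
  obtain ⟨c, u, hu⟩ := h.exists_star4_sub_eq hl hNl hH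
  obtain ⟨d, w, hw⟩ := h.exists_star4_sub_eq hm hNm hH
  have hlm' : l - m ≠ 0 := sub_ne_zero.2 hlm
  refine ⟨-c / (l - m), d / (l - m), u, w, ?_⟩
  have h1 : (l - m) • v = d • hvec σ w w - c • hvec σ u u := by
    rw [← hu, ← hw, sub_smul]; abel
  rw [← inv_smul_smul₀ hlm' v, h1, smul_sub, smul_smul, smul_smul]
  rw [neg_div, neg_smul, div_eq_inv_mul, div_eq_inv_mul]
  abel

theorem exists_eq_smul_twisted (hr : q = 2 * r + 1) {θ a b : F} {u w : F × F} (hb : b ≠ 0)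
    (hθ0 : θ ≠ 0) (hab : a ^ r = θ ^ r * b ^ r) (huw : pairDet u w = 1) :
    ∃ (c : F) (u' w' : F × F), c ≠ 0 ∧ pairDet u' w' = 1 ∧
      a • hvec σ u u + b • hvec σ w w = c • (θ • hvec σ u' u' + hvec σ w' w') := by
  have h1 : (a / (θ * b)) ^ r = 1 := by
    rw [div_pow, mul_pow, hab, div_self]
    exact mul_ne_zero (pow_ne_zero _ hθ0) (pow_ne_zero _ hb)
  obtain ⟨k, hk0, hk⟩ := exists_eq_pow_of_pow_eq_one (k := 2 * (q + 1))
    (by rw [h.card_sub_one, hr]; simp; ring) h1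
  rw [div_eq_iff (mul_ne_zero hθ0 hb), mul_comm 2, pow_mul, h.norm_eq] at hk
  have hσk : σ k ≠ 0 := by simpa using hk0
  refine ⟨b * (k * σ k), k • u, k⁻¹ • w, mul_ne_zero hb (mul_ne_zero hk0 hσk), ?_, ?_⟩
  · rw [pairDet_smul, huw, mul_inv_cancel₀ hk0, mul_one]
  · rw [hvec_smul, hvec_smul, smul_add, smul_smul, smul_smul, smul_smul, hk, map_inv₀]
    congr 2
    · ring
    · field_simp

theorem fgam_eq_zero_iff (hr : q = 2 * r + 1) {θ : F} (hθ0 : θ ≠ 0) (hθ : σ θ ≠ θ)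
    (hθ' : σ θ ≠ -θ) {v : Fin 4 → F} (hv : v ≠ 0) :
    Fgam q (θ ^ r + (θ ^ r)⁻¹) v = 0 ↔
      (∃ (c : F) (u : F × F), c ≠ 0 ∧ u ≠ 0 ∧ v = c • hvec σ u u) ∨
      ∃ (c : F) (u w : F × F), c ≠ 0 ∧ pairDet u w = 1 ∧
        v = c • (θ • hvec σ u u + hvec σ w w) := by
  have hr' : (q + 1) / 2 = r + 1 := by omega
  have hε : θ ^ r ≠ 0 := pow_ne_zero _ hθ0
  have hγ := h.add_inv_ne_zero hr hθ0 hθ'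
  have hσθ := h.apply_eq_mul_self hr θ
  have hNε := h.pow_ne_zero_sq_norm hr hθ0
  set ε := θ ^ r with hεdef
  rw [h.fgam_eq, hr', sub_eq_zero]
  constructor
  · intro hH
    by_cases hd : det4 v = 0
    · left
      rw [hd, zero_pow (Nat.succ_ne_zero r), mul_zero] at hH
      obtain ⟨c, u, rfl⟩ := h.exists_eq_smul_hvec hd hH
      refine ⟨c, u, ?_, ?_, rfl⟩
      · rintro rfl
        simp at hv
      · rintro rfl
        apply hv
        rw [(hvec_eq_zero_iff σ).2 (Or.inl rfl), smul_zero]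
    · right
      have hdr : det4 v ^ r ≠ 0 := pow_ne_zero _ hd
      have hNd := h.pow_ne_zero_sq_norm hr hd
      have hσd := h.apply_eq_mul_self hr (det4 v)
      have hH0 : herm4 σ v ≠ 0 := by
        rw [hH]
        exact mul_ne_zero hγ (pow_ne_zero _ hd)
      obtain ⟨a, b, u, w, hvab⟩ : ∃ (a b : F) (u w : F × F),
          v = a • hvec σ u u + b • hvec σ w w := by
        apply h.exists_eq_diag (l := ε * det4 v ^ r) (m := ε⁻¹ * det4 v ^ r) ?_ ?_ ?_ ?_ ?_ hH0
        · intro h1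
          have h2 := mul_right_cancel₀ hdr h1
          apply hθ
          rw [hσθ]
          field_simp at h2
          rw [h2, one_mul]
        · rw [hσd, hH, pow_succ]
          field_simp
          ring
        · rw [map_mul]
          linear_combination (det4 v ^ r * σ (det4 v ^ r)) ^ 2 * hNε + hNd
        · rw [hσd, hH, pow_succ]
          field_simp
          ring
        · have h3 : (ε⁻¹ * σ ε⁻¹) ^ 2 = 1 := by
            rw [map_inv₀, ← mul_inv, inv_pow, hNε, inv_one]
          rw [map_mul]
          linear_combination (det4 v ^ r * σ (det4 v ^ r)) ^ 2 * h3 + hNd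
      have hdet : pairDet u w ≠ 0 := by
        intro h0
        apply hd
        rw [hvab, det4_diag, h0]
        simp
      have hσdet : σ (pairDet u w) ≠ 0 := by simpa using hdet
      obtain ⟨a, u, hvab, huw⟩ : ∃ (a' : F) (u' : F × F),
          v = a' • hvec σ u' u' + b • hvec σ w w ∧ pairDet u' w = 1 := by
        refine ⟨a * (pairDet u w * σ (pairDet u w)), (pairDet u w)⁻¹ • u, ?_, ?_⟩
        · rw [hvab, hvec_smul, smul_smul, map_inv₀]
          congr 2
          field_simp
        · have := pairDet_smul (pairDet u w)⁻¹ 1 u w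
          rw [one_smul, mul_one, inv_mul_cancel₀ hdet] at this
          exact this
      have hdet1 : det4 v = a * b := by rw [hvab, det4_diag, huw]; simp
      have hherm1 : herm4 σ v = a * σ b + σ a * b := by rw [hvab, h.herm4_diag, huw]; simp
      have ha : a ≠ 0 := fun h0 => hd (by rw [hdet1, h0, zero_mul])
      have hb : b ≠ 0 := fun h0 => hd (by rw [hdet1, h0, mul_zero])
      rw [hherm1, hdet1, h.apply_eq_mul_self hr a, h.apply_eq_mul_self hr b, mul_pow,
        pow_succ, pow_succ] at hH
      have hfac : (a ^ r - ε * b ^ r) * (b ^ r - ε * a ^ r) = 0 := by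
        apply mul_left_cancel₀ (mul_ne_zero ha hb)
        field_simp at hH
        linear_combination -hH
      rcases mul_eq_zero.1 hfac with h1 | h1
      · rw [hvab]
        exact h.exists_eq_smul_twisted hr hb hθ0 (sub_eq_zero.1 h1) huw
      · have h2 : v = b • hvec σ w w + a • hvec σ ((-1 : F) • u) ((-1 : F) • u) := by
          rw [hvec_smul, hvab, add_comm]
          simp
        rw [h2]
        refine h.exists_eq_smul_twisted hr ha hθ0 (sub_eq_zero.1 h1) ?_
        simp only [pairDet, Prod.smul_fst, Prod.smul_snd, smul_eq_mul] at huw ⊢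
        linear_combination huw
  · rintro (⟨c, u, hc, hu, rfl⟩ | ⟨c, u, w, hc, huw, rfl⟩)
    · rw [herm4_smul, det4_smul, h.herm4_hvec]
      have h1 : det4 (hvec σ u u) = 0 := by simp [det4, hvec]; ring
      have h2 : pairDet u u = 0 := by simp [pairDet]; ring
      rw [h1, h2]
      simp
    · have h1 := det4_diag σ θ 1 u w
      have h2 := h.herm4_diag θ 1 u w
      rw [one_smul] at h1 h2
      rw [herm4_smul, det4_smul, h1, h2, huw, h.apply_eq_mul_self hr c, hσθ]
      simp only [map_one, mul_one, one_mul, mul_pow, pow_succ, pow_zero]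
      field_simp
      ring

end IsQuadConj
end Cgam

section PointSets

open scoped Classical

theorem card_filter_comp {α β : Type*} (S : Finset α) (g : α → β) {k : ℕ}
    (hk : ∀ a ∈ S, (S.filter fun x => g x = g a).card = k) (P : β → Prop) :
    (S.filter fun x => P (g x)).card = k * ((S.image g).filter P).card := by
  rw [Finset.card_eq_sum_card_image g, Finset.filter_image]
  refine (Finset.sum_const_nat fun b hb => ?_).trans (mul_comm _ _)
  obtain ⟨a, ha, rfl⟩ := Finset.mem_image.1 hb
  obtain ⟨ha, hPb⟩ := Finset.mem_filter.1 ha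
  rw [Finset.filter_filter, ← hk a ha]
  congr 1
  refine Finset.filter_congr fun x _ => and_iff_right_of_imp fun hx => ?_
  rwa [hx]

variable {F : Type*} [Field F]

/-- The projective point spanned by a nonzero vector. -/
def toPoint (v : Fin 4 → F) : PGPoint F :=
  if hv : v ≠ 0 then Projectivization.mk F v hv else Classical.arbitrary _

theorem toPoint_eq {v : Fin 4 → F} (hv : v ≠ 0) : toPoint v = Projectivization.mk F v hv :=
  dif_pos hv

theorem toPoint_eq_iff {v w : Fin 4 → F} (hv : v ≠ 0) (hw : w ≠ 0) :
    toPoint v = toPoint w ↔ ∃ c : F, v = c • w := by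
  rw [toPoint_eq hv, toPoint_eq hw, Projectivization.mk_eq_mk_iff']
  simp only [eq_comm]

theorem toPoint_smul {c : F} (hc : c ≠ 0) (v : Fin 4 → F) : toPoint (c • v) = toPoint v := by
  by_cases hv : v = 0
  · simp [hv]
  · exact (toPoint_eq_iff (smul_ne_zero hc hv) hv).2 ⟨c, rfl⟩

theorem dotProduct_rep_toPoint {N v : Fin 4 → F} (hv : v ≠ 0) :
    N ⬝ᵥ (toPoint v).rep = 0 ↔ N ⬝ᵥ v = 0 := by
  rw [toPoint_eq hv]
  obtain ⟨a, ha⟩ := Projectivization.exists_smul_eq_mk_rep F v hv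
  rw [← ha, dotProduct_smul, smul_eq_zero_iff_eq]

theorem ne_zero_of_pairDet_eq_one {u w : F × F} (h : pairDet u w = 1) : u ≠ 0 ∧ w ≠ 0 := by
  constructor <;> rintro rfl <;> simp [pairDet] at h

theorem exists_inv_smul_of_pairDet_eq_one {u w u' w' : F × F} (huw : pairDet u w = 1)
    (huw' : pairDet u' w' = 1) (hu : ∃ κ : F, u' = κ • u) (hw : ∃ κ : F, w' = κ • w) :
    ∃ κ : F, κ ≠ 0 ∧ u' = κ • u ∧ w' = κ⁻¹ • w := by
  obtain ⟨κ, rfl⟩ := hu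
  obtain ⟨κ', rfl⟩ := hw
  rw [pairDet_smul, huw, mul_one] at huw'
  have hκ : κ ≠ 0 := left_ne_zero_of_mul_eq_one huw'
  exact ⟨κ, hκ, rfl, by rw [eq_inv_of_mul_eq_one_right huw']⟩

variable [Fintype F] {σ : F →+* F}

theorem card_filter_pairDet {m : ℕ} {k : ℕ} (hm : Fintype.card F - 1 = k * m)
    {g : (F × F) × (F × F) → PGPoint F}
    (hg : ∀ u w u' w' : F × F, pairDet u w = 1 → pairDet u' w' = 1 →
      (g (u', w') = g (u, w) ↔ ∃ κ : F, κ ^ m = 1 ∧ u' = κ • u ∧ w' = κ⁻¹ • w))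
    (P : PGPoint F → Prop) :
    (Finset.univ.filter fun p : (F × F) × (F × F) => pairDet p.1 p.2 = 1 ∧ P (g p)).card
      = m * (((Finset.univ.filter fun p : (F × F) × (F × F) =>
        pairDet p.1 p.2 = 1).image g).filter P).card := by
  rw [← card_filter_comp, Finset.filter_filter]
  rintro ⟨u, w⟩ huw
  simp only [Finset.mem_filter, Finset.mem_univ, true_and] at huw
  have hu := (ne_zero_of_pairDet_eq_one huw).1
  rw [← card_filter_pow_eq_one hm, ← Finset.card_image_of_injective
    (f := fun κ : F => (κ • u, κ⁻¹ • w))]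
  · congr 1
    ext ⟨u', w'⟩
    simp only [Finset.mem_filter, Finset.mem_univ, true_and, Finset.mem_image, Prod.mk.injEq]
    constructor
    · rintro ⟨h1, h2⟩
      obtain ⟨κ, h3, h4, h5⟩ := (hg _ _ _ _ huw h1).1 h2
      exact ⟨κ, h3, h4.symm, h5.symm⟩
    · rintro ⟨κ, h3, rfl, rfl⟩
      have hκ : κ ≠ 0 := by
        rintro rfl
        have := Fintype.one_lt_card (α := F)
        rw [zero_pow (by rintro rfl; omega)] at h3
        exact zero_ne_one h3
      have h1 : pairDet (κ • u) (κ⁻¹ • w) = 1 := by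
        rw [pairDet_smul, huw, mul_inv_cancel₀ hκ, mul_one]
      exact ⟨h1, (hg _ _ _ _ huw h1).2 ⟨κ, h3, rfl, rfl⟩⟩
  · intro κ κ' hκ
    exact smul_left_injective F hu (Prod.ext_iff.1 hκ).1

namespace IsQuadConj

variable {q : ℕ} (h : IsQuadConj q σ)
include h

theorem twisted_eq_smul_iff {θ : F} (hθ0 : θ ≠ 0) (hθ : σ θ ≠ θ) {u w u' w' : F × F}
    (huw : pairDet u w = 1) (huw' : pairDet u' w' = 1) :
    (∃ c : F, θ • hvec σ u' u' + hvec σ w' w' = c • (θ • hvec σ u u + hvec σ w w)) ↔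
      ∃ κ : F, κ ^ (2 * (q + 1)) = 1 ∧ u' = κ • u ∧ w' = κ⁻¹ • w := by
  obtain ⟨hu, hw⟩ := ne_zero_of_pairDet_eq_one huw
  obtain ⟨hu', hw'⟩ := ne_zero_of_pairDet_eq_one huw'
  constructor
  · rintro ⟨c, hc⟩
    have hdet : ∀ u w : F × F, pairDet u w = 1 → det4 (θ • hvec σ u u + hvec σ w w) = θ := by
      intro u w huw
      have := det4_diag σ θ 1 u w
      rw [one_smul, huw] at this
      simpa using this
    have hc2 : c ^ 2 = 1 := by
      have := congrArg det4 hc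
      rw [det4_smul, hdet _ _ huw, hdet _ _ huw'] at this
      exact (mul_eq_right₀ hθ0).1 this.symm
    have hσc : σ c = c := by
      rcases sq_eq_one_iff.1 hc2 with rfl | rfl <;> simp
    have hst := congrArg (star4 σ) hc
    simp only [star4_smul, star4_add, h.star4_hvec, hσc] at hst
    have hθ' : θ - σ θ ≠ 0 := sub_ne_zero.2 hθ.symm
    have h1 : hvec σ u' u' = c • hvec σ u u := by
      have h2 : (θ - σ θ) • hvec σ u' u' = (θ - σ θ) • (c • hvec σ u u) := by
        funext i
        have h3 := congrFun hc i
        have h4 := congrFun hst i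
        simp only [Pi.smul_apply, Pi.add_apply, smul_eq_mul] at h3 h4 ⊢
        linear_combination h3 - h4
      exact smul_right_injective _ hθ' h2
    have h2 : hvec σ w' w' = c • hvec σ w w := by
      rw [h1] at hc
      funext i
      have h3 := congrFun hc i
      simp only [Pi.smul_apply, Pi.add_apply, smul_eq_mul] at h3 ⊢
      linear_combination h3
    obtain ⟨κ, hκ, rfl, rfl⟩ := exists_inv_smul_of_pairDet_eq_one huw huw'
      (exists_smul_right_of_hvec_eq σ hu' h1) (exists_smul_right_of_hvec_eq σ hw' h2)
    refine ⟨κ, ?_, rfl, rfl⟩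
    rw [hvec_smul] at h1
    have h3 : hvec σ u u ≠ 0 := fun h0 => hu (by simpa using (hvec_eq_zero_iff σ).1 h0)
    have h4 : σ κ * κ = c := smul_left_injective F h3 h1
    rw [mul_comm, pow_mul, h.norm_eq, mul_comm, h4, hc2]
  · rintro ⟨κ, hκ, rfl, rfl⟩
    rw [mul_comm, pow_mul, h.norm_eq] at hκ
    refine ⟨κ * σ κ, ?_⟩
    have hinv : κ⁻¹ * σ κ⁻¹ = κ * σ κ := by
      rw [map_inv₀, ← mul_inv]
      exact inv_eq_of_mul_eq_one_left (by rw [← sq]; exact hκ)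
    rw [hvec_smul, hvec_smul, mul_comm (σ κ⁻¹), hinv, mul_comm (σ κ), smul_add,
      smul_comm]

theorem skew_eq_smul_iff {ζ : F} (hζ : ζ * σ ζ = -1) {u w u' w' : F × F}
    (huw : pairDet u w = 1) (huw' : pairDet u' w' = 1) :
    (∃ c : F, ζ • hvec σ u' w' + hvec σ w' u' = c • (ζ • hvec σ u w + hvec σ w u)) ↔
      ∃ κ : F, κ ^ (2 * (q - 1)) = 1 ∧ u' = κ • u ∧ w' = κ⁻¹ • w := by
  obtain ⟨hu, hw⟩ := ne_zero_of_pairDet_eq_one huw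
  obtain ⟨hu', hw'⟩ := ne_zero_of_pairDet_eq_one huw'
  have hζ0 : ζ ≠ 0 := by
    rintro rfl
    simp at hζ
  have hq : q = q - 1 + 1 := by have := h.three_le; omega
  constructor
  · rintro ⟨c, hc⟩
    have hc2 : c ^ 2 = 1 := by
      have := congrArg det4 hc
      rw [det4_smul, det4_skew, det4_skew, huw, huw', map_one, mul_one, mul_one] at this
      exact (mul_eq_right₀ (neg_ne_zero.2 hζ0)).1 this.symm
    have hσc : σ c = c := by
      rcases sq_eq_one_iff.1 hc2 with rfl | rfl <;> simp
    have hst := congrArg (star4 σ) hc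
    simp only [star4_smul, star4_add, h.star4_hvec, hσc] at hst
    have h1 : hvec σ u' w' = c • hvec σ u w := by
      apply smul_right_injective _ (mul_ne_zero h.two_ne_zero hζ0)
      funext i
      have h3 := congrFun hc i
      have h4 := congrFun hst i
      simp only [Pi.smul_apply, Pi.add_apply, smul_eq_mul] at h3 h4 ⊢
      linear_combination h3 + ζ * h4 - (hvec σ w' u' i - c * hvec σ w u i) * hζ
    have h2 : hvec σ w' u' = c • hvec σ w u := by
      rw [h1] at hc
      funext i
      have h3 := congrFun hc i
      simp only [Pi.smul_apply, Pi.add_apply, smul_eq_mul] at h3 ⊢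
      linear_combination h3
    obtain ⟨κ, hκ, rfl, rfl⟩ := exists_inv_smul_of_pairDet_eq_one huw huw'
      (exists_smul_right_of_hvec_eq σ hw' h2) (exists_smul_right_of_hvec_eq σ hu' h1)
    refine ⟨κ, ?_, rfl, rfl⟩
    rw [hvec_smul] at h1
    have h3 : hvec σ u w ≠ 0 := fun h0 => ((hvec_eq_zero_iff σ).1 h0).elim hu hw
    have h4 : σ κ * κ⁻¹ = c := smul_left_injective F h3 h1
    rw [h.apply_eq, hq, pow_succ, mul_assoc, mul_inv_cancel₀ hκ, mul_one] at h4
    rw [mul_comm, pow_mul, h4, hc2]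
  · rintro ⟨κ, hκ, rfl, rfl⟩
    have hκ0 : κ ≠ 0 := by
      rintro rfl
      rw [zero_pow (by have := h.three_le; omega)] at hκ
      exact zero_ne_one hκ
    have h1 : σ κ = κ ^ (q - 1) * κ := by rw [h.apply_eq, ← pow_succ, ← hq]
    have hκ' : κ ^ (q - 1) ≠ 0 := pow_ne_zero _ hκ0
    refine ⟨κ ^ (q - 1), ?_⟩
    rw [hvec_smul, hvec_smul, smul_add, smul_comm, map_inv₀, h1]
    congr 2
    · field_simp
    · rw [mul_comm 2, pow_mul] at hκ
      field_simp
      exact hκ.symm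

end IsQuadConj
end PointSets

section QuasiHermitian

open scoped Classical

variable {F : Type*} [Field F] {σ : F →+* F}

theorem hvec_self_ne_zero {u : F × F} (hu : u ≠ 0) : hvec σ u u ≠ 0 :=
  fun h0 => hu (by simpa using (hvec_eq_zero_iff σ).1 h0)

theorem det4_twisted {θ : F} {u w : F × F} (huw : pairDet u w = 1) :
    det4 (θ • hvec σ u u + hvec σ w w) = θ := by
  have := det4_diag σ θ 1 u w
  rw [one_smul, huw] at this
  simpa using this

theorem det4_skew_eq {ζ : F} {u w : F × F} (huw : pairDet u w = 1) :
    det4 (ζ • hvec σ u w + hvec σ w u) = -ζ := by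
  rw [det4_skew, huw]
  simp

theorem twisted_ne_zero {θ : F} (hθ : θ ≠ 0) {u w : F × F} (huw : pairDet u w = 1) :
    θ • hvec σ u u + hvec σ w w ≠ 0 :=
  ne_zero_of_det4_ne_zero (by rwa [det4_twisted huw])

theorem skew_ne_zero {ζ : F} (hζ : ζ ≠ 0) {u w : F × F} (huw : pairDet u w = 1) :
    ζ • hvec σ u w + hvec σ w u ≠ 0 :=
  ne_zero_of_det4_ne_zero (by rwa [det4_skew_eq huw, neg_ne_zero])

variable [Fintype F]

/-- The Hermitian Veronese curve. -/
def diagPoints (σ : F →+* F) : Finset (PGPoint F) :=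
  (Finset.univ.filter fun u : F × F => u ≠ 0).image fun u => toPoint (hvec σ u u)

/-- The points of `C_γ` off the Hermitian Veronese curve. -/
def twistedPoints (σ : F →+* F) (θ : F) : Finset (PGPoint F) :=
  (Finset.univ.filter fun p : (F × F) × (F × F) => pairDet p.1 p.2 = 1).image fun p =>
    toPoint (θ • hvec σ p.1 p.1 + hvec σ p.2 p.2)

/-- The points of the orbit `H₂`. -/
def skewPoints (σ : F →+* F) (ζ : F) : Finset (PGPoint F) :=
  (Finset.univ.filter fun p : (F × F) × (F × F) => pairDet p.1 p.2 = 1).image fun p =>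
    toPoint (ζ • hvec σ p.1 p.2 + hvec σ p.2 p.1)

/-- The number of points of a finite set in the hyperplane with coordinates `N`. -/
def planeCard (V : Finset (PGPoint F)) (N : Fin 4 → F) : ℕ :=
  (V.filter fun P => N ⬝ᵥ P.rep = 0).card

theorem mem_diagPoints {P : PGPoint F} :
    P ∈ diagPoints σ ↔ ∃ u : F × F, u ≠ 0 ∧ toPoint (hvec σ u u) = P := by
  simp [diagPoints]

theorem mem_twistedPoints {θ : F} {P : PGPoint F} :
    P ∈ twistedPoints σ θ ↔
      ∃ u w, pairDet u w = 1 ∧ toPoint (θ • hvec σ u u + hvec σ w w) = P := by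
  simp only [twistedPoints, Finset.mem_image, Finset.mem_filter, Finset.mem_univ, true_and,
    Prod.exists]

theorem mem_skewPoints {ζ : F} {P : PGPoint F} :
    P ∈ skewPoints σ ζ ↔
      ∃ u w, pairDet u w = 1 ∧ toPoint (ζ • hvec σ u w + hvec σ w u) = P := by
  simp only [skewPoints, Finset.mem_image, Finset.mem_filter, Finset.mem_univ, true_and,
    Prod.exists]

theorem disjoint_diagPoints_twistedPoints {θ : F} (hθ : θ ≠ 0) :
    Disjoint (diagPoints σ) (twistedPoints σ θ) := by
  rw [Finset.disjoint_left]
  intro P h1 h2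
  obtain ⟨u, hu, rfl⟩ := mem_diagPoints.1 h1
  obtain ⟨u', w', huw, h3⟩ := mem_twistedPoints.1 h2
  obtain ⟨c, hc⟩ := (toPoint_eq_iff (twisted_ne_zero hθ huw) (hvec_self_ne_zero hu)).1 h3
  apply hθ
  rw [← det4_twisted (σ := σ) (θ := θ) huw, hc, det4_smul]
  simp only [det4, hvec, Matrix.cons_val]
  ring

theorem disjoint_diagPoints_skewPoints {ζ : F} (hζ : ζ ≠ 0) :
    Disjoint (diagPoints σ) (skewPoints σ ζ) := by
  rw [Finset.disjoint_left]
  intro P h1 h2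
  obtain ⟨u, hu, rfl⟩ := mem_diagPoints.1 h1
  obtain ⟨u', w', huw, h3⟩ := mem_skewPoints.1 h2
  obtain ⟨c, hc⟩ := (toPoint_eq_iff (skew_ne_zero hζ huw) (hvec_self_ne_zero hu)).1 h3
  apply neg_ne_zero.2 hζ
  rw [← det4_skew_eq (σ := σ) huw, hc, det4_smul]
  simp only [det4, hvec, Matrix.cons_val]
  ring

namespace IsQuadConj

variable {q : ℕ} (h : IsQuadConj q σ)
include h

theorem disjoint_twistedPoints_skewPoints {θ ζ : F} (hθ0 : θ ≠ 0) (hθ' : σ θ ≠ -θ)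
    (hζ : ζ * σ ζ = -1) : Disjoint (twistedPoints σ θ) (skewPoints σ ζ) := by
  have hζ0 : ζ ≠ 0 := by
    rintro rfl
    simp at hζ
  rw [Finset.disjoint_left]
  intro P h1 h2
  obtain ⟨u, w, huw, rfl⟩ := mem_twistedPoints.1 h1
  obtain ⟨u', w', huw', h3⟩ := mem_skewPoints.1 h2
  obtain ⟨c, hc⟩ := (toPoint_eq_iff (twisted_ne_zero hθ0 huw) (skew_ne_zero hζ0 huw')).1 h3.symm
  apply hθ'
  have h4 := h.herm4_diag θ 1 u w
  rw [one_smul, hc, herm4_smul, h.herm4_skew hζ, huw] at h4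
  simp only [map_one, mul_one, mul_zero] at h4
  linear_combination -h4

theorem card_diagPoints_filter (P : PGPoint F → Prop) :
    (Finset.univ.filter fun u : F × F => u ≠ 0 ∧ P (toPoint (hvec σ u u))).card
      = (q ^ 2 - 1) * ((diagPoints σ).filter P).card := by
  rw [diagPoints, ← card_filter_comp, Finset.filter_filter]
  intro u hu
  simp only [Finset.mem_filter, Finset.mem_univ, true_and] at hu
  have hcard : (Finset.univ.filter fun κ : F => κ ≠ 0).card = q ^ 2 - 1 := by
    rw [Finset.filter_ne', Finset.card_erase_of_mem (Finset.mem_univ _), Finset.card_univ,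
      h.card_eq]
  rw [← hcard, ← Finset.card_image_of_injective (f := fun κ : F => κ • u) _
    (smul_left_injective F hu)]
  congr 1
  ext u'
  simp only [Finset.mem_filter, Finset.mem_univ, true_and, Finset.mem_image]
  constructor
  · rintro ⟨hu', h1⟩
    obtain ⟨c, hc⟩ := (toPoint_eq_iff (hvec_self_ne_zero hu') (hvec_self_ne_zero hu)).1 h1
    obtain ⟨κ, rfl⟩ := exists_smul_right_of_hvec_eq σ hu' hc
    exact ⟨κ, (smul_ne_zero_iff.1 hu').1, rfl⟩
  · rintro ⟨κ, hκ, rfl⟩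
    refine ⟨smul_ne_zero hκ hu, ?_⟩
    rw [hvec_smul, toPoint_smul]
    exact mul_ne_zero (by simpa using hκ) hκ

theorem card_twistedPoints_filter {θ : F} (hθ0 : θ ≠ 0) (hθ : σ θ ≠ θ) (P : PGPoint F → Prop) :
    (Finset.univ.filter fun p : (F × F) × (F × F) => pairDet p.1 p.2 = 1 ∧
      P (toPoint (θ • hvec σ p.1 p.1 + hvec σ p.2 p.2))).card
      = 2 * (q + 1) * ((twistedPoints σ θ).filter P).card := by
  obtain ⟨r, hr⟩ := h.odd
  refine card_filter_pairDet (k := r) ?_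
    (g := fun p => toPoint (θ • hvec σ p.1 p.1 + hvec σ p.2 p.2)) ?_ P
  · rw [h.card_sub_one, hr]; simp; ring
  · intro u w u' w' huw huw'
    rw [← h.twisted_eq_smul_iff hθ0 hθ huw huw']
    exact toPoint_eq_iff (twisted_ne_zero hθ0 huw') (twisted_ne_zero hθ0 huw)

theorem card_skewPoints_filter {ζ : F} (hζ : ζ * σ ζ = -1) (P : PGPoint F → Prop) :
    (Finset.univ.filter fun p : (F × F) × (F × F) => pairDet p.1 p.2 = 1 ∧
      P (toPoint (ζ • hvec σ p.1 p.2 + hvec σ p.2 p.1))).card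
      = 2 * (q - 1) * ((skewPoints σ ζ).filter P).card := by
  have hζ0 : ζ ≠ 0 := by
    rintro rfl
    simp at hζ
  obtain ⟨r, hr⟩ := h.odd
  refine card_filter_pairDet (k := r + 1) ?_
    (g := fun p => toPoint (ζ • hvec σ p.1 p.2 + hvec σ p.2 p.1)) ?_ P
  · rw [h.card_sub_one, hr]; simp; ring
  · intro u w u' w' huw huw'
    rw [← h.skew_eq_smul_iff hζ huw huw']
    exact toPoint_eq_iff (skew_ne_zero hζ0 huw') (skew_ne_zero hζ0 huw)

/-- Weighted count of the points in a hyperplane through the parametrizations. -/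
theorem mul_planeCard {θ ζ : F} (hθ0 : θ ≠ 0) (hθ : σ θ ≠ θ) (hθ' : σ θ ≠ -θ)
    (hζ : ζ * σ ζ = -1) (N : Fin 4 → F) :
    2 * ((q : ℤ) ^ 2 - 1) * planeCard (diagPoints σ ∪ twistedPoints σ θ ∪ skewPoints σ ζ) N
      = 2 * (Finset.univ.filter fun u : F × F => u ≠ 0 ∧ sesq σ N u u = 0).card
        + (q - 1) * (Finset.univ.filter fun p : (F × F) × (F × F) => pairDet p.1 p.2 = 1 ∧
          θ * sesq σ N p.1 p.1 + sesq σ N p.2 p.2 = 0).card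
        + (q + 1) * (Finset.univ.filter fun p : (F × F) × (F × F) => pairDet p.1 p.2 = 1 ∧
          ζ * sesq σ N p.1 p.2 + sesq σ N p.2 p.1 = 0).card := by
  have hζ0 : ζ ≠ 0 := by
    rintro rfl
    simp at hζ
  have hq := h.three_le
  have e1 : (Finset.univ.filter fun u : F × F => u ≠ 0 ∧ sesq σ N u u = 0)
      = Finset.univ.filter fun u : F × F => u ≠ 0 ∧ N ⬝ᵥ (toPoint (hvec σ u u)).rep = 0 := by
    refine Finset.filter_congr fun u _ => and_congr_right fun hu => ?_
    rw [dotProduct_rep_toPoint (hvec_self_ne_zero hu), dotProduct_hvec]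
  have e2 : (Finset.univ.filter fun p : (F × F) × (F × F) => pairDet p.1 p.2 = 1 ∧
      θ * sesq σ N p.1 p.1 + sesq σ N p.2 p.2 = 0)
      = Finset.univ.filter fun p : (F × F) × (F × F) => pairDet p.1 p.2 = 1 ∧
        N ⬝ᵥ (toPoint (θ • hvec σ p.1 p.1 + hvec σ p.2 p.2)).rep = 0 := by
    refine Finset.filter_congr fun u _ => and_congr_right fun hu => ?_
    rw [dotProduct_rep_toPoint (twisted_ne_zero hθ0 hu), dotProduct_add, dotProduct_smul,
      dotProduct_hvec, dotProduct_hvec, smul_eq_mul]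
  have e3 : (Finset.univ.filter fun p : (F × F) × (F × F) => pairDet p.1 p.2 = 1 ∧
      ζ * sesq σ N p.1 p.2 + sesq σ N p.2 p.1 = 0)
      = Finset.univ.filter fun p : (F × F) × (F × F) => pairDet p.1 p.2 = 1 ∧
        N ⬝ᵥ (toPoint (ζ • hvec σ p.1 p.2 + hvec σ p.2 p.1)).rep = 0 := by
    refine Finset.filter_congr fun u _ => and_congr_right fun hu => ?_
    rw [dotProduct_rep_toPoint (skew_ne_zero hζ0 hu), dotProduct_add, dotProduct_smul,
      dotProduct_hvec, dotProduct_hvec, smul_eq_mul]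
  rw [e1, e2, e3, h.card_diagPoints_filter fun P => N ⬝ᵥ P.rep = 0,
    h.card_twistedPoints_filter hθ0 hθ fun P => N ⬝ᵥ P.rep = 0,
    h.card_skewPoints_filter hζ fun P => N ⬝ᵥ P.rep = 0]
  rw [planeCard, Finset.filter_union, Finset.filter_union, Finset.card_union_of_disjoint,
    Finset.card_union_of_disjoint]
  · push_cast [Nat.cast_sub (show 1 ≤ q ^ 2 by nlinarith), Nat.cast_sub (show 1 ≤ q by omega)]
    ring
  · exact Finset.disjoint_filter_filter (disjoint_diagPoints_twistedPoints hθ0)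
  · rw [← Finset.filter_union]
    exact Finset.disjoint_filter_filter (Finset.disjoint_union_left.2
      ⟨disjoint_diagPoints_skewPoints hζ0, h.disjoint_twistedPoints_skewPoints hθ0 hθ' hζ⟩)

theorem card_quasiHermitian {θ ζ : F} (hθ0 : θ ≠ 0) (hθ : σ θ ≠ θ) (hθ' : σ θ ≠ -θ)
    (hζ : ζ * σ ζ = -1) :
    (diagPoints σ ∪ twistedPoints σ θ ∪ skewPoints σ ζ).card = (q ^ 2 + 1) * (q ^ 3 + 1) := by
  have h1 := h.mul_planeCard hθ0 hθ hθ' hζ 0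
  have h2 : ∀ u w : F × F, sesq σ 0 u w = 0 := by simp [sesq]
  simp only [h2, mul_zero, add_zero, and_true, h.card_prod_ne_zero, h.card_pairDet_eq_one,
    planeCard, zero_dotProduct, Finset.filter_true] at h1
  have hq : (3 : ℤ) ≤ q := by exact_mod_cast h.three_le
  zify
  apply mul_left_cancel₀ (a := 2 * ((q : ℤ) ^ 2 - 1)) (by nlinarith)
  rw [h1]
  ring

theorem dvd_planeCard_sub_one {θ ζ : F} (hθ0 : θ ≠ 0) (hθ : σ θ ≠ θ) (hθ' : σ θ ≠ -θ)
    (hζ : ζ * σ ζ = -1) (N : Fin 4 → F) :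
    (q ^ 2 : ℤ) ∣ planeCard (diagPoints σ ∪ twistedPoints σ θ ∪ skewPoints σ ζ) N - 1 := by
  have h1 := h.mul_planeCard hθ0 hθ hθ' hζ N
  obtain ⟨s, hs⟩ := h.dvd_card_twisted_zeros hθ N
  obtain ⟨t, ht⟩ := h.dvd_card_skew_zeros hζ N
  have hcop : IsCoprime ((q : ℤ) ^ 2) 2 := by
    obtain ⟨r, hr⟩ := h.odd.pow (n := 2)
    refine ⟨1, -r, ?_⟩
    have : (q : ℤ) ^ 2 = 2 * r + 1 := by exact_mod_cast hr
    rw [this]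
    ring
  apply hcop.dvd_of_dvd_mul_left
  set f : ℤ := (planeCard (diagPoints σ ∪ twistedPoints σ θ ∪ skewPoints σ ζ) N : ℤ)
  refine ⟨2 * f - (q - 1) * s - (q + 1) * t, ?_⟩
  linear_combination -h1 - (q - 1) * hs - (q + 1) * ht

end IsQuadConj
end QuasiHermitian

section Moments

open scoped Classical

variable {F : Type*} [Field F] [Fintype F]

theorem card_mulVec_eq_zero {k : ℕ} {M : Matrix (Fin k) (Fin 4) F}
    (hM : LinearIndependent F M.row) (hk : k ≤ 4) :
    (Finset.univ.filter fun N : Fin 4 → F => M *ᵥ N = 0).card = Fintype.card F ^ (4 - k) := by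
  have h1 := LinearMap.finrank_range_add_finrank_ker M.mulVecLin
  have h2 : Module.finrank F (LinearMap.range M.mulVecLin) = k := by
    have := hM.rank_matrix
    rwa [Fintype.card_fin] at this
  rw [h2, Module.finrank_fin_fun] at h1
  have h3 : Module.finrank F (LinearMap.ker M.mulVecLin) = 4 - k := by omega
  rw [← h3, ← Module.card_eq_pow_finrank, Fintype.card_subtype]
  congr 1
  ext N
  simp

theorem card_dotProduct_eq_zero (P : PGPoint F) :
    (Finset.univ.filter fun N : Fin 4 → F => N ⬝ᵥ P.rep = 0).card = Fintype.card F ^ 3 := by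
  rw [← card_mulVec_eq_zero (k := 1) (M := Matrix.of ![P.rep]) _ (by omega)]
  · congr 1
    ext N
    simp [funext_iff, dotProduct_comm]
  · rw [linearIndependent_unique_iff]
    exact P.rep_nonzero

theorem card_dotProduct_eq_zero_pair {P P' : PGPoint F} (hP : P ≠ P') :
    (Finset.univ.filter fun N : Fin 4 → F => N ⬝ᵥ P.rep = 0 ∧ N ⬝ᵥ P'.rep = 0).card
      = Fintype.card F ^ 2 := by
  rw [← card_mulVec_eq_zero (k := 2) (M := Matrix.of ![P.rep, P'.rep]) _ (by omega)]
  · congr 1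
    ext N
    simp [funext_iff, dotProduct_comm, Fin.forall_fin_two]
  · have := (Projectivization.independent_iff (f := ![P, P'])).1
      ((Projectivization.independent_pair_iff_ne P P').2 hP)
    have hrow : (Matrix.of ![P.rep, P'.rep]).row = Projectivization.rep ∘ ![P, P'] := by
      funext i
      fin_cases i <;> rfl
    rwa [hrow]

theorem sum_planeCard (V : Finset (PGPoint F)) :
    ∑ N, planeCard V N = V.card * Fintype.card F ^ 3 := by
  simp_rw [planeCard, Finset.card_filter]
  rw [Finset.sum_comm]
  simp_rw [← Finset.card_filter, card_dotProduct_eq_zero]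
  rw [Finset.sum_const, smul_eq_mul]

theorem sum_planeCard_sq (V : Finset (PGPoint F)) :
    ∑ N, (planeCard V N : ℤ) ^ 2
      = V.card * (Fintype.card F : ℤ) ^ 3 + V.card * (V.card - 1) * (Fintype.card F : ℤ) ^ 2 := by
  have h1 : ∀ N : Fin 4 → F, (planeCard V N : ℤ) ^ 2
      = ∑ P ∈ V, ∑ P' ∈ V, if N ⬝ᵥ P.rep = 0 ∧ N ⬝ᵥ P'.rep = 0 then 1 else 0 := by
    intro N
    rw [planeCard, Finset.card_filter, Nat.cast_sum, sq, Finset.sum_mul_sum]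
    simp only [Nat.cast_ite, Nat.cast_one, Nat.cast_zero, ite_and, mul_ite, mul_one, mul_zero]
    refine Finset.sum_congr rfl fun P _ => Finset.sum_congr rfl fun P' _ => ?_
    split_ifs <;> rfl
  have h2 : ∀ P P' : PGPoint F,
      ∑ N : Fin 4 → F, (if N ⬝ᵥ P.rep = 0 ∧ N ⬝ᵥ P'.rep = 0 then 1 else 0 : ℤ)
        = (Fintype.card F : ℤ) ^ 2
          + if P = P' then (Fintype.card F : ℤ) ^ 3 - (Fintype.card F : ℤ) ^ 2 else 0 := by
    intro P P'
    rw [Finset.sum_boole]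
    split_ifs with hP
    · subst hP
      simp only [and_self]
      rw [card_dotProduct_eq_zero]
      push_cast
      ring
    · rw [card_dotProduct_eq_zero_pair hP]
      push_cast
      ring
  simp_rw [h1]
  rw [Finset.sum_comm]
  have h3 : ∀ P ∈ V, ∑ N : Fin 4 → F, ∑ P' ∈ V,
      (if N ⬝ᵥ P.rep = 0 ∧ N ⬝ᵥ P'.rep = 0 then 1 else 0 : ℤ)
      = V.card * (Fintype.card F : ℤ) ^ 2
        + ((Fintype.card F : ℤ) ^ 3 - (Fintype.card F : ℤ) ^ 2) := by
    intro P hP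
    rw [Finset.sum_comm]
    simp_rw [h2]
    rw [Finset.sum_add_distrib, Finset.sum_ite_eq, if_pos hP, Finset.sum_const, nsmul_eq_mul]
  rw [Finset.sum_congr rfl h3, Finset.sum_const, nsmul_eq_mul]
  ring

/-- A set of points with the size of a Hermitian surface, all of whose plane intersection numbers
are `1` modulo `q ^ 2`, is quasi-Hermitian. -/
theorem planeCard_eq_or_eq {q : ℕ} (hq : 0 < q) (hF : Fintype.card F = q ^ 2)
    {V : Finset (PGPoint F)} (hV : V.card = (q ^ 2 + 1) * (q ^ 3 + 1))
    (hdvd : ∀ N, (q ^ 2 : ℤ) ∣ planeCard V N - 1) {N : Fin 4 → F} (hN : N ≠ 0) :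
    planeCard V N = q ^ 3 + 1 ∨ planeCard V N = q ^ 3 + q ^ 2 + 1 := by
  set g : (Fin 4 → F) → ℤ := fun N =>
    ((planeCard V N : ℤ) - (q ^ 3 + 1)) * (planeCard V N - (q ^ 3 + q ^ 2 + 1)) with hg
  have hnonneg : ∀ N, 0 ≤ g N := by
    intro N
    obtain ⟨m, hm⟩ := hdvd N
    have h1 : g N = q ^ 4 * ((m - q) * (m - q - 1)) := by
      simp only [hg, sub_eq_iff_eq_add.1 hm]
      ring
    rw [h1]
    apply mul_nonneg (by positivity)
    rcases le_or_gt (m - q) 0 with h2 | h2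
    · exact mul_nonneg_of_nonpos_of_nonpos h2 (by omega)
    · exact mul_nonneg h2.le (by omega)
  have hV' : (V.card : ℤ) = (q ^ 2 + 1) * (q ^ 3 + 1) := by exact_mod_cast hV
  have hF' : (Fintype.card F : ℤ) = q ^ 2 := by exact_mod_cast hF
  have hsum : ∑ N, g N = g 0 := by
    have h1 : (∑ N, (planeCard V N : ℤ)) = V.card * (Fintype.card F : ℤ) ^ 3 := by
      exact_mod_cast sum_planeCard V
    have h2 := sum_planeCard_sq V
    have h3 : ∀ N, g N = (planeCard V N : ℤ) ^ 2 - (2 * q ^ 3 + q ^ 2 + 2) * planeCard V N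
        + (q ^ 3 + 1) * (q ^ 3 + q ^ 2 + 1) := by
      intro N
      simp only [hg]
      ring
    have h4 : (planeCard V 0 : ℤ) = V.card := by simp [planeCard]
    rw [h3, h4]
    simp_rw [h3]
    rw [Finset.sum_add_distrib, Finset.sum_sub_distrib, ← Finset.mul_sum, h1, h2, Finset.sum_const,
      Finset.card_univ, Fintype.card_fun, Fintype.card_fin, nsmul_eq_mul, Nat.cast_pow, hF', hV']
    ring
  have h5 : g N = 0 := by
    have h6 := Finset.add_sum_erase Finset.univ g (Finset.mem_univ 0)
    rw [hsum, add_eq_left, Finset.sum_eq_zero_iff_of_nonneg fun N _ => hnonneg N] at h6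
    exact h6 N (Finset.mem_erase.2 ⟨hN, Finset.mem_univ _⟩)
  rcases mul_eq_zero.1 h5 with h6 | h6
  · left
    zify
    linarith
  · right
    zify
    linarith

omit [Fintype F] in
theorem exists_dotProduct_of_finrank_eq_three {W : Submodule F (Fin 4 → F)}
    (hW : Module.finrank F W = 3) :
    ∃ N : Fin 4 → F, N ≠ 0 ∧ ∀ v, v ∈ W ↔ N ⬝ᵥ v = 0 := by
  have hne : W ≠ ⊤ := by
    rintro rfl
    rw [finrank_top, Module.finrank_fin_fun] at hW
    omega
  obtain ⟨f, hf, hWf⟩ := Submodule.exists_le_ker_of_lt_top W (lt_top_iff_ne_top.2 hne)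
  have hker : Module.finrank F (LinearMap.ker f) = 3 := by
    have h1 := Module.Dual.finrank_ker_add_one_of_ne_zero hf
    rw [Module.finrank_fin_fun] at h1
    omega
  have hWker : W = LinearMap.ker f :=
    Submodule.eq_of_le_of_finrank_eq hWf (hW.trans hker.symm)
  have hfN : ∀ v, f v = (fun i => f fun j => if i = j then 1 else 0) ⬝ᵥ v := by
    intro v
    rw [LinearMap.pi_apply_eq_sum_univ, dotProduct]
    exact Finset.sum_congr rfl fun i _ => mul_comm _ _
  refine ⟨fun i => f fun j => if i = j then 1 else 0, ?_, fun v => ?_⟩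
  · intro h0
    apply hf
    refine LinearMap.ext fun v => ?_
    rw [hfN, h0, zero_dotProduct, LinearMap.zero_apply]
  · rw [hWker, LinearMap.mem_ker, hfN]

end Moments

section Assembly

variable {F : Type*} [Field F] [Fintype F] {σ : F →+* F} {q : ℕ}

omit [Fintype F] in
theorem toPoint_rep (P : PGPoint F) : toPoint P.rep = P := by
  rw [toPoint_eq P.rep_nonzero, Projectivization.mk_rep]

omit [Fintype F] in
theorem mem_Cgam_toPoint {γ : F} {v : Fin 4 → F} (hv : v ≠ 0)
    (hγ : ∀ c : F, c ≠ 0 → Fgam q γ v = 0 → Fgam q γ (c • v) = 0) :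
    toPoint v ∈ Cgam q γ ↔ Fgam q γ v = 0 := by
  constructor
  · intro h
    exact h v hv (toPoint_eq hv)
  · intro h w hw hvw
    rw [toPoint_eq hv, eq_comm, Projectivization.mk_eq_mk_iff'] at hvw
    obtain ⟨c, rfl⟩ := hvw
    exact hγ c (smul_ne_zero_iff.1 hw).1 h

namespace IsQuadConj

variable (h : IsQuadConj q σ)
include h

theorem Cgam_eq {r : ℕ} (hr : q = 2 * r + 1) {θ : F} (hθ0 : θ ≠ 0) (hθ : σ θ ≠ θ)
    (hθ' : σ θ ≠ -θ) :
    Cgam q (θ ^ r + (θ ^ r)⁻¹) = {P | P ∈ diagPoints σ ∨ P ∈ twistedPoints σ θ} := by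
  ext P
  obtain ⟨v, hv, rfl⟩ : ∃ v : Fin 4 → F, v ≠ 0 ∧ toPoint v = P :=
    ⟨P.rep, P.rep_nonzero, toPoint_rep P⟩
  rw [mem_Cgam_toPoint hv, h.fgam_eq_zero_iff hr hθ0 hθ hθ' hv, Set.mem_ofPred_eq, mem_diagPoints,
    mem_twistedPoints]
  · refine or_congr ⟨?_, ?_⟩ ⟨?_, ?_⟩
    · rintro ⟨c, u, hc, hu, rfl⟩
      exact ⟨u, hu, (toPoint_smul hc _).symm⟩
    · rintro ⟨u, hu, huv⟩
      obtain ⟨c, rfl⟩ := (toPoint_eq_iff hv (hvec_self_ne_zero hu)).1 huv.symm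
      exact ⟨c, u, (smul_ne_zero_iff.1 hv).1, hu, rfl⟩
    · rintro ⟨c, u, w, hc, huw, rfl⟩
      exact ⟨u, w, huw, (toPoint_smul hc _).symm⟩
    · rintro ⟨u, w, huw, huv⟩
      obtain ⟨c, rfl⟩ := (toPoint_eq_iff hv (twisted_ne_zero hθ0 huw)).1 huv.symm
      exact ⟨c, u, w, (smul_ne_zero_iff.1 hv).1, huw, rfl⟩
  · intro c hc
    rw [h.fgam_eq_zero_iff hr hθ0 hθ hθ' hv, h.fgam_eq_zero_iff hr hθ0 hθ hθ' (smul_ne_zero hc hv)]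
    rintro (⟨a, u, ha, hu, rfl⟩ | ⟨a, u, w, ha, huw, rfl⟩)
    · exact Or.inl ⟨c * a, u, mul_ne_zero hc ha, hu, smul_smul _ _ _⟩
    · exact Or.inr ⟨c * a, u, w, mul_ne_zero hc ha, huw, smul_smul _ _ _⟩

theorem vecMul_kron (c ζ : F) (A : Matrix (Fin 2) (Fin 2) F) :
    (c • ![0, ζ, 1, 0]) ᵥ* kron (matq q A) A
      = c • (ζ • hvec σ (A 0 0, A 0 1) (A 1 0, A 1 1)
        + hvec σ (A 1 0, A 1 1) (A 0 0, A 0 1)) := by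
  rw [smul_vecMul]
  congr 1
  apply funext_fin_four <;>
    simp [vecMul, dotProduct, Fin.sum_univ_four, kron, matq, hvec, h.apply_eq]

theorem Korb_eq {ζ : F} (hζ0 : ζ ≠ 0) (hv : ![0, ζ, 1, 0] ≠ 0) :
    Korb q (Projectivization.mk F ![0, ζ, 1, 0] hv) = {P | P ∈ skewPoints σ ζ} := by
  ext P
  rw [Set.mem_ofPred_eq, mem_skewPoints]
  constructor
  · rintro ⟨A, hA, v, hv', hw, h1, rfl⟩
    rw [eq_comm, Projectivization.mk_eq_mk_iff'] at h1
    obtain ⟨c, rfl⟩ := h1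
    rw [← toPoint_eq hw, h.vecMul_kron, toPoint_smul (smul_ne_zero_iff.1 hv').1]
    refine ⟨_, _, ?_, rfl⟩
    rw [det_fin_two] at hA
    simp only [pairDet]
    linear_combination hA
  · rintro ⟨u, w, huw, rfl⟩
    have h1 := h.vecMul_kron 1 ζ !![u.1, u.2; w.1, w.2]
    rw [one_smul, one_smul] at h1
    have hne := skew_ne_zero (σ := σ) hζ0 huw
    refine ⟨!![u.1, u.2; w.1, w.2], ?_, ![0, ζ, 1, 0], hv, ?_, rfl, ?_⟩
    · rw [det_fin_two]
      simp only [pairDet] at huw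
      simpa using huw
    · rw [h1]
      exact hne
    · rw [← toPoint_eq, h1]
      rfl

end IsQuadConj

theorem exists_isQuadConj {p n : ℕ} (hp : p.Prime) (hodd : Odd p)
    (hF : Fintype.card F = (p ^ n) ^ 2) : ∃ σ : F →+* F, IsQuadConj (p ^ n) σ := by
  have := Fact.mk hp
  have : CharP F p := charP_of_card_eq_prime_pow (f := n * 2) (by rw [hF, pow_mul])
  refine ⟨iterateFrobenius F p n, hF, fun x => iterateFrobenius_def p n x, hodd.pow⟩

theorem orderOf_of_forall_eq_pow {ξ : F} (hξ : ∀ x : F, x ≠ 0 → ∃ m : ℕ, x = ξ ^ m)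
    (h0 : ξ ≠ 0) : orderOf ξ = Fintype.card F - 1 := by
  classical
  have h1 : ∀ x : Fˣ, x ∈ Subgroup.zpowers (Units.mk0 ξ h0) := by
    intro x
    obtain ⟨m, hm⟩ := hξ x x.ne_zero
    exact ⟨m, Units.ext (by simp [hm])⟩
  rw [← Units.val_mk0 h0, orderOf_units, orderOf_eq_card_of_forall_mem_zpowers h1,
    Nat.card_eq_fintype_card, Fintype.card_units]

end Assembly

/-- Theorem 2.29 (second family): `S_j ∪ H₂` is a quasi-Hermitian surface of
    `PG(3,q²)`, where `H₂` is the `K`-orbit of the point `(0, ξ^{(q−1)/2}, 1, 0)`. -/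
theorem stmt17 {F : Type*} [Field F] [Fintype F] (p n q : ℕ) (hp : p.Prime)
    (hodd : Odd p) (hn : 0 < n) (hq : q = p ^ n) (hF : Fintype.card F = q ^ 2)
    (ξ : F) (hξ : ∀ x : F, x ≠ 0 → ∃ m : ℕ, x = ξ ^ m)
    (j : ℕ) (hj1 : 1 ≤ j) (hjq : j ≤ q) (hjne : j ≠ (q + 1) / 2) :
    let H2 : Set (PGPoint F) := Korb q (Projectivization.mk F
      ![0, ξ ^ ((q - 1) / 2), 1, 0] (by intro h; have := congrFun h 2; simp at this))
    let V : Set (PGPoint F) :=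
      Cgam q (ξ ^ (j * (q - 1) / 2) + (ξ ^ (j * (q - 1) / 2))⁻¹) ∪ H2
    V.ncard = (q ^ 2 + 1) * (q ^ 3 + 1) ∧
      ∀ π : Set (PGPoint F), IsPlane π →
        (π ∩ V).ncard = q ^ 3 + 1 ∨ (π ∩ V).ncard = q ^ 3 + q ^ 2 + 1 := by
  classical
  intro H2 V
  obtain ⟨σ, h⟩ : ∃ σ : F →+* F, IsQuadConj q σ := by
    subst hq
    exact exists_isQuadConj hp hodd hF
  obtain ⟨r, hr⟩ := h.odd
  have hq3 := h.three_le
  have hξ0 : ξ ≠ 0 := by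
    rintro rfl
    obtain ⟨m, hm⟩ := hξ (-1) (by simp)
    rcases m with _ | m
    · exact h.two_ne_zero (by linear_combination -hm)
    · simp at hm
  have hord := orderOf_of_forall_eq_pow hξ hξ0
  rw [h.card_sub_one] at hord
  have hθ2 : ξ ^ (2 * j * (q - 1)) ≠ 1 := by
    rw [Ne, ← orderOf_dvd_iff_pow_eq_one, hord, mul_comm (q - 1)]
    intro hdvd
    obtain ⟨s, hs⟩ := Nat.dvd_of_mul_dvd_mul_right (by omega) hdvd
    have : s < 2 := by nlinarith
    interval_cases s <;> omega
  have hσξ : σ (ξ ^ j) = ξ ^ (j * (q - 1)) * ξ ^ j := by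
    rw [h.apply_eq, ← pow_mul, ← pow_add]
    congr 1
    obtain ⟨k, rfl⟩ : ∃ k, q = k + 1 := ⟨q - 1, by omega⟩
    simp
    ring
  have hθ0 : ξ ^ j ≠ 0 := pow_ne_zero _ hξ0
  have hθ : σ (ξ ^ j) ≠ ξ ^ j := by
    rw [hσξ, Ne, mul_eq_right₀ hθ0]
    intro h1
    exact hθ2 (by rw [mul_assoc, mul_comm, pow_mul, h1, one_pow])
  have hθ' : σ (ξ ^ j) ≠ -ξ ^ j := by
    rw [hσξ, ← neg_one_mul, Ne, mul_left_inj' hθ0]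
    intro h1
    exact hθ2 (by rw [mul_assoc, mul_comm, pow_mul, h1]; simp)
  have hr2 : (q - 1) / 2 = r := by omega
  have hr3 : j * (q - 1) / 2 = j * r := by
    rw [Nat.mul_div_assoc _ (by omega), hr2]
  have hζ : ξ ^ r * σ (ξ ^ r) = -1 := by
    rw [← h.norm_eq, ← pow_mul]
    have h1 : (ξ ^ (r * (q + 1))) ^ 2 = 1 := by
      rw [← pow_mul, ← orderOf_dvd_iff_pow_eq_one, hord, hr]
      exact ⟨1, by simp; ring⟩
    refine (sq_eq_one_iff.1 h1).resolve_left fun h2 => ?_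
    rw [← orderOf_dvd_iff_pow_eq_one, hord] at h2
    have := Nat.dvd_of_mul_dvd_mul_right (by omega) h2
    have := Nat.le_of_dvd (by omega) this
    omega
  have hζ0 : ξ ^ r ≠ 0 := pow_ne_zero _ hξ0
  set S := diagPoints σ ∪ twistedPoints σ (ξ ^ j) ∪ skewPoints σ (ξ ^ r) with hS
  have hVS : V = ↑S := by
    have h1 : H2 = {P | P ∈ skewPoints σ (ξ ^ r)} := by
      simp only [H2, hr2]
      exact h.Korb_eq hζ0 _
    simp only [V, h1, hr3, pow_mul]
    rw [h.Cgam_eq hr hθ0 hθ hθ']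
    ext P
    simp [hS, or_assoc]
  have hcard := h.card_quasiHermitian hθ0 hθ hθ' hζ
  have hdvd := h.dvd_planeCard_sub_one hθ0 hθ hθ' hζ
  refine ⟨?_, ?_⟩
  · rw [hVS, Set.ncard_coe_finset]
    exact hcard
  · rintro π ⟨W, hW, rfl⟩
    obtain ⟨N, hN, hWN⟩ := exists_dotProduct_of_finrank_eq_three hW
    have h1 : {P : PGPoint F | P.rep ∈ W} ∩ V = ↑(S.filter fun P => N ⬝ᵥ P.rep = 0) := by
      ext P
      simp [hVS, hWN, and_comm]
    rw [h1, Set.ncard_coe_finset]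
    exact planeCard_eq_or_eq (by omega) hF hcard hdvd hN
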